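/- Let n ≥ 3, let (L_i : 1 ≤ i ≤ n) be a nondegenerate n-tuple of surjective linear maps ℝ² → ℝ, and let (E_i : 1 ≤ i ≤ n) be an admissible n-tuple of measurable subsets of ℝ. If I(E_1, ..., E_n) = I(E_1^*, ..., E_n^*), then there exist a point z ∈ ℝ² and intervals J_i ⊂ ℝ with center L_i(z) such that |E_i △ J_i| = 0 for every i. -/

import Mathlib

open MeasureTheory Set

/-- The closed interval centered at `0` with the same measure as `E`. -/
def symInt (E : Set ℝ) : Set ℝ :=
  Set.Icc (-(MeasureTheory.volume E).toReal / 2) ((MeasureTheory.volume E).toReal / 2)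

namespace BLL

open Filter Topology

/-- The distribution function of the Lebesgue measure restricted to a set. -/
noncomputable def massBelow (X : Set ℝ) (x : ℝ) : ℝ := volume.real (X ∩ Iic x)

lemma measureReal_inter_ne_top {X : Set ℝ} (hX : volume X ≠ ⊤) (S : Set ℝ) :
    volume (X ∩ S) ≠ ⊤ := measure_ne_top_of_subset inter_subset_left hX

lemma massBelow_sub {X : Set ℝ} (hX : volume X ≠ ⊤) {x y : ℝ} (h : x ≤ y) :
    massBelow X y - massBelow X x = volume.real (X ∩ Ioc x y) := by
  have : X ∩ Iic y = (X ∩ Iic x) ∪ (X ∩ Ioc x y) := by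
    rw [← inter_union_distrib_left, Iic_union_Ioc_eq_Iic h]
  have hd : volume.real (X ∩ Iic y) = volume.real (X ∩ Iic x) + volume.real (X ∩ Ioc x y) := by
    have h1 := measureReal_inter_add_sdiff (μ := volume) (s := X ∩ Iic y) (t := Iic x)
      measurableSet_Iic (measureReal_inter_ne_top hX _)
    have e1 : X ∩ Iic y ∩ Iic x = X ∩ Iic x := by
      ext z; simp only [mem_inter_iff, mem_Iic]; constructor
      · tauto
      · rintro ⟨a, b⟩; exact ⟨⟨a, b.trans h⟩, b⟩
    have e2 : (X ∩ Iic y) \ Iic x = X ∩ Ioc x y := by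
      ext z; simp only [mem_inter_iff, mem_Iic, Set.mem_sdiff, mem_Ioc, not_le]; tauto
    rw [e1, e2] at h1
    exact h1.symm
  unfold massBelow; linarith

lemma massBelow_mono {X : Set ℝ} (hX : volume X ≠ ⊤) : Monotone (massBelow X) := by
  intro x y h
  have := massBelow_sub hX h
  have : 0 ≤ volume.real (X ∩ Ioc x y) := measureReal_nonneg
  linarith

lemma massBelow_sub_le {X : Set ℝ} (hX : volume X ≠ ⊤) {x y : ℝ} (h : x ≤ y) :
    massBelow X y - massBelow X x ≤ y - x := by
  rw [massBelow_sub hX h]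
  calc volume.real (X ∩ Ioc x y) ≤ volume.real (Ioc x y) :=
        measureReal_mono inter_subset_right (by simp)
    _ = y - x := by simp [h]

lemma massBelow_continuous {X : Set ℝ} (hX : volume X ≠ ⊤) : Continuous (massBelow X) := by
  have : LipschitzWith 1 (massBelow X) := by
    refine LipschitzWith.of_le_add fun x y => ?_
    rcases le_total x y with h | h
    · have := massBelow_mono hX h
      have := dist_nonneg (x := x) (y := y)
      linarith
    · have := massBelow_sub_le hX h
      rw [Real.dist_eq, abs_of_nonneg (by linarith)]; linarith
  exact this.continuous

lemma massBelow_nonneg (X : Set ℝ) (x : ℝ) : 0 ≤ massBelow X x := measureReal_nonneg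

lemma massBelow_le {X : Set ℝ} (hX : volume X ≠ ⊤) (x : ℝ) : massBelow X x ≤ volume.real X :=
  measureReal_mono inter_subset_left hX

lemma measureReal_inter_Ioi {X : Set ℝ} (hX : volume X ≠ ⊤) (x : ℝ) :
    volume.real (X ∩ Ioi x) = volume.real X - massBelow X x := by
  have h1 := measureReal_inter_add_sdiff (μ := volume) (s := X) (t := Iic x)
      measurableSet_Iic hX
  rw [sdiff_eq, compl_Iic] at h1
  unfold massBelow; linarith

lemma exists_massBelow_eq {X : Set ℝ} (hX : volume X ≠ ⊤) {d : ℝ} (h0 : 0 < d)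
    (h1 : d < volume.real X) : ∃ x, massBelow X x = d := by
  have hv : volume X = ENNReal.ofReal (volume.real X) := (ofReal_measureReal hX).symm
  have hu : (volume.restrict X) univ = ENNReal.ofReal (volume.real X) := by simp [← hv]
  have htop := tendsto_measure_Iic_atTop (volume.restrict X)
  have hbot := tendsto_measure_Ici_atBot (volume.restrict X)
  rw [hu] at htop hbot
  obtain ⟨y, hy⟩ := (htop.eventually_const_lt (u := ENNReal.ofReal d)
    ((ENNReal.ofReal_lt_ofReal_iff (by linarith)).2 h1)).exists
  obtain ⟨x, hx⟩ := (hbot.eventually_const_lt (u := ENNReal.ofReal (volume.real X - d))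
    ((ENNReal.ofReal_lt_ofReal_iff (by linarith)).2 (by linarith))).exists
  rw [Measure.restrict_apply measurableSet_Iic, inter_comm] at hy
  rw [Measure.restrict_apply measurableSet_Ici, inter_comm] at hx
  refine mem_range_of_exists_le_of_exists_ge (massBelow_continuous hX) ⟨x - 1, ?_⟩ ⟨y, ?_⟩
  · have h2 : volume.real X - d ≤ volume.real (X ∩ Ioi (x - 1)) := by
      refine (ENNReal.ofReal_le_iff_le_toReal (measureReal_inter_ne_top hX _)).1
        (hx.le.trans (measure_mono (inter_subset_inter_right _ fun z hz => ?_)))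
      simp only [mem_Ici, mem_Ioi] at *; linarith
    rw [measureReal_inter_Ioi hX] at h2
    linarith
  · exact (ENNReal.ofReal_le_iff_le_toReal (measureReal_inter_ne_top hX _)).1 hy.le

lemma ae_hasDerivAt_massBelow {X : Set ℝ} (hm : MeasurableSet X) (hX : volume X ≠ ⊤) :
    ∀ᵐ x, x ∈ X → HasDerivAt (massBelow X) 1 x := by
  have hi : Integrable (X.indicator (fun _ => (1 : ℝ))) volume :=
    (integrable_indicator_iff hm).2 (integrableOn_const hX)
  filter_upwards [LocallyIntegrable.ae_hasDerivAt_integral hi.locallyIntegrable] with x hx hxX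
  have h := (hx (x - 1)).add_const (massBelow X (x - 1))
  rw [indicator_of_mem hxX] at h
  refine h.congr_of_eventuallyEq ?_
  filter_upwards [Ioi_mem_nhds (show x - 1 < x by linarith)] with y hy
  rw [intervalIntegral.integral_of_le (le_of_lt hy), setIntegral_indicator hm]
  have := massBelow_sub hX (le_of_lt hy)
  rw [inter_comm, setIntegral_const, ← this]
  simp

lemma measure_le_of_ae {α : Type*} [MeasurableSpace α] {μ : Measure α} {S T : Set α}
    (h : ∀ᵐ x ∂μ, x ∈ S → x ∈ T) : μ S ≤ μ T := measure_mono_ae h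

lemma exists_mem_of_ae {X : Set ℝ} {p : ℝ → Prop} (hX : volume X ≠ 0)
    (h : ∀ᵐ x, x ∈ X → p x) : ∃ x ∈ X, p x := by
  by_contra! hc
  refine hX (measure_mono_null (fun x hx => ?_) h)
  simpa using ⟨hx, hc x hx⟩

/-- A measure-theoretic form of the one-dimensional Brunn-Minkowski inequality. -/
lemma measureReal_add_le {X Y A : Set ℝ} (hX : volume X ≠ ⊤) (hY : volume Y ≠ ⊤)
    (hA : volume A ≠ ⊤) (hX0 : 0 < volume.real X) (hY0 : 0 < volume.real Y)
    (h : ∀ᵐ q : ℝ × ℝ, q.1 ∈ X → q.2 ∈ Y → q.1 + q.2 ∈ A) :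
    volume.real X + volume.real Y ≤ volume.real A := by
  have h1 : ∀ᵐ x : ℝ, ∀ᵐ y : ℝ, x ∈ X → y ∈ Y → x + y ∈ A := Measure.ae_ae_of_ae_prod h
  have h2 : ∀ᵐ y : ℝ, ∀ᵐ x : ℝ, x ∈ X → y ∈ Y → x + y ∈ A :=
    Measure.ae_ae_of_ae_prod
      (Measure.measurePreserving_swap (μ := (volume : Measure ℝ))
        (ν := (volume : Measure ℝ))|>.quasiMeasurePreserving.ae h)
  refine le_of_forall_pos_le_add fun ε hε => ?_
  obtain ⟨d, hd0, hdX, hdY, hdε⟩ : ∃ d, 0 < d ∧ d < volume.real X ∧ d < volume.real Y ∧ d < ε/2 :=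
    ⟨min (min (volume.real X) (volume.real Y)) (ε/2) / 2, by positivity, by
      have := min_le_left (min (volume.real X) (volume.real Y)) (ε/2)
      have := min_le_left (volume.real X) (volume.real Y); linarith, by
      have := min_le_left (min (volume.real X) (volume.real Y)) (ε/2)
      have := min_le_right (volume.real X) (volume.real Y); linarith, by
      have := min_le_right (min (volume.real X) (volume.real Y)) (ε/2); linarith⟩
  obtain ⟨α, hα⟩ := exists_massBelow_eq hX (d := volume.real X - d) (by linarith) (by linarith)
  obtain ⟨β, hβ⟩ := exists_massBelow_eq hY hd0 hdY
  have hXα : volume (X ∩ Ioi α) ≠ 0 := by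
    intro h0
    have := measureReal_inter_Ioi hX α
    rw [measureReal_def, h0] at this
    simp at this; linarith
  have hYβ : volume (Y ∩ Iic β) ≠ 0 := by
    intro h0
    rw [massBelow, measureReal_def, h0] at hβ
    simp at hβ; linarith
  obtain ⟨x, ⟨hxX, hxα⟩, hx⟩ := exists_mem_of_ae hXα (h1.mono fun x hx _ => hx)
  obtain ⟨y, ⟨hyY, hyβ⟩, hy⟩ := exists_mem_of_ae hYβ (h2.mono fun x hx _ => hx)
  have e1 : volume.real X - d ≤ massBelow A (x + y) := by
    calc volume.real X - d ≤ volume.real (X ∩ Iic x) := by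
          rw [← hα]; exact massBelow_mono hX (le_of_lt hxα)
      _ = volume.real ((fun z => z + y) ⁻¹' ((fun z => z - y) ⁻¹' (X ∩ Iic x))) := by
          congr 1; ext z; simp
      _ = volume.real ((fun z => z - y) ⁻¹' (X ∩ Iic x)) := by
          simp only [measureReal_def, measure_preimage_add_right]
      _ ≤ _ := by
          refine ENNReal.toReal_mono (measureReal_inter_ne_top hA _) (measure_le_of_ae ?_)
          have := (measurePreserving_sub_right volume y).quasiMeasurePreserving.ae hy
          filter_upwards [this] with z hz hzz
          change z - y ∈ X ∩ Iic x at hzz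
          refine ⟨?_, ?_⟩
          · have := hz hzz.1 hyY
            simpa using this
          · have := mem_Iic.1 hzz.2
            simp only [mem_Iic]; linarith
  have e2 : volume.real Y - d ≤ volume.real (A ∩ Ioi (x + y)) := by
    calc volume.real Y - d ≤ volume.real (Y ∩ Ioi y) := by
          rw [measureReal_inter_Ioi hY, ← hβ]
          have := massBelow_mono hY hyβ; linarith
      _ = volume.real ((fun z => z + x) ⁻¹' ((fun z => z - x) ⁻¹' (Y ∩ Ioi y))) := by
          congr 1; ext z; simp
      _ = volume.real ((fun z => z - x) ⁻¹' (Y ∩ Ioi y)) := by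
          simp only [measureReal_def, measure_preimage_add_right]
      _ ≤ _ := by
          refine ENNReal.toReal_mono (measureReal_inter_ne_top hA _) (measure_le_of_ae ?_)
          have := (measurePreserving_sub_right volume x).quasiMeasurePreserving.ae hx
          filter_upwards [this] with z hz hzz
          change z - x ∈ Y ∩ Ioi y at hzz
          refine ⟨?_, ?_⟩
          · have := hz hxX hzz.1
            simpa using this
          · have := mem_Ioi.1 hzz.2
            simp only [mem_Ioi]; linarith
  rw [measureReal_inter_Ioi hA] at e2
  linarith

lemma massBelow_add_le {X Y A : Set ℝ} (hX : volume X ≠ ⊤) (hY : volume Y ≠ ⊤)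
    (hA : volume A ≠ ⊤) (h : ∀ᵐ q : ℝ × ℝ, q.1 ∈ X → q.2 ∈ Y → q.1 + q.2 ∈ A) {x y : ℝ}
    (hx : 0 < massBelow X x) (hy : 0 < massBelow Y y) :
    massBelow X x + massBelow Y y ≤ massBelow A (x + y) := by
  refine measureReal_add_le (measureReal_inter_ne_top hX _) (measureReal_inter_ne_top hY _)
    (measureReal_inter_ne_top hA _) hx hy ?_
  filter_upwards [h] with q hq h1 h2
  exact ⟨hq h1.1 h2.1, mem_Iic.2 (add_le_add h1.2 h2.2)⟩

lemma le_massBelow_add {X Y A : Set ℝ} (hX : volume X ≠ ⊤) (hY : volume Y ≠ ⊤)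
    (hA : volume A ≠ ⊤) (h : ∀ᵐ q : ℝ × ℝ, q.1 ∈ X → q.2 ∈ Y → q.1 + q.2 ∈ A)
    (hle : volume.real A ≤ volume.real X + volume.real Y) {x y : ℝ}
    (hx : massBelow X x < volume.real X) (hy : massBelow Y y < volume.real Y) :
    massBelow A (x + y) ≤ massBelow X x + massBelow Y y := by
  have hx' := measureReal_inter_Ioi hX x
  have hy' := measureReal_inter_Ioi hY y
  have hA' := measureReal_inter_Ioi hA (x + y)
  have := measureReal_add_le (measureReal_inter_ne_top hX (Ioi x))
    (measureReal_inter_ne_top hY (Ioi y)) (measureReal_inter_ne_top hA (Ioi (x + y)))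
    (by linarith) (by linarith) (by
      filter_upwards [h] with q hq h1 h2
      exact ⟨hq h1.1 h2.1, mem_Ioi.2 (add_lt_add h1.2 h2.2)⟩)
  linarith

/-- The points splitting a set into two parts of positive measure. -/
def splitting (X : Set ℝ) : Set ℝ := {x | 0 < massBelow X x ∧ massBelow X x < volume.real X}

lemma isOpen_splitting {X : Set ℝ} (hX : volume X ≠ ⊤) : IsOpen (splitting X) :=
  (isOpen_lt continuous_const (massBelow_continuous hX)).inter
    (isOpen_lt (massBelow_continuous hX) continuous_const)

lemma ordConnected_splitting {X : Set ℝ} (hX : volume X ≠ ⊤) : OrdConnected (splitting X) :=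
  ⟨fun _ hx _ hy _ hz => ⟨hx.1.trans_le (massBelow_mono hX hz.1),
    (massBelow_mono hX hz.2).trans_lt hy.2⟩⟩

lemma exists_mem_splitting {X : Set ℝ} (hX : volume X ≠ ⊤) (h0 : 0 < volume.real X) :
    ∃ x, x ∈ splitting X := by
  obtain ⟨x, hx⟩ := exists_massBelow_eq hX (d := volume.real X / 2) (by linarith) (by linarith)
  exact ⟨x, by rw [splitting, mem_ofPred_eq, hx]; constructor <;> linarith⟩

lemma exists_hasDerivAt_massBelow {X : Set ℝ} (hm : MeasurableSet X) (hX : volume X ≠ ⊤)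
    (h0 : 0 < volume.real X) : ∃ x ∈ splitting X, HasDerivAt (massBelow X) 1 x := by
  obtain ⟨x, hx⟩ := exists_massBelow_eq hX (d := volume.real X / 3) (by linarith) (by linarith)
  obtain ⟨y, hy⟩ := exists_massBelow_eq hX (d := 2 * volume.real X / 3) (by linarith) (by linarith)
  have hxy : x ≤ y := by
    by_contra! hc
    have := massBelow_mono hX hc.le
    linarith
  have hpos : volume (X ∩ Ioc x y) ≠ 0 := by
    intro h
    have h2 := massBelow_sub hX hxy
    rw [measureReal_def, h] at h2
    simp at h2; linarith
  obtain ⟨z, hz, hd⟩ := exists_mem_of_ae hpos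
    ((ae_hasDerivAt_massBelow hm hX).mono fun z hz (h : z ∈ X ∩ Ioc x y) => hz h.1)
  refine ⟨z, ⟨?_, ?_⟩, hd⟩
  · have := massBelow_mono hX hz.2.1.le; linarith
  · have := massBelow_mono hX hz.2.2; linarith

/-- The left-hand side of an equality in the one-dimensional Brunn-Minkowski inequality has
a distribution function of slope one. -/
lemma hasDerivAt_massBelow_of_add {X Y A : Set ℝ} (hX : volume X ≠ ⊤) (hY : volume Y ≠ ⊤)
    (hadd : ∀ x ∈ splitting X, ∀ y ∈ splitting Y,
      massBelow A (x + y) = massBelow X x + massBelow Y y) {x₀ : ℝ} (hx₀ : x₀ ∈ splitting X)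
    (hd : HasDerivAt (massBelow X) 1 x₀) {y : ℝ} (hy : y ∈ splitting Y) :
    HasDerivAt (massBelow Y) 1 y := by
  have h1 : HasDerivAt (fun z => massBelow X (z + (x₀ - y)) + (massBelow Y y - massBelow X x₀))
      1 y := by
    refine HasDerivAt.add_const _ (HasDerivAt.comp_add_const y (x₀ - y) ?_)
    simpa using hd
  refine h1.congr_of_eventuallyEq ?_
  have c1 : ∀ᶠ z in 𝓝 y, z + (x₀ - y) ∈ splitting X :=
    ContinuousAt.preimage_mem_nhds (by fun_prop)
      ((isOpen_splitting hX).mem_nhds (by simpa using hx₀))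
  filter_upwards [c1, (isOpen_splitting hY).mem_nhds hy] with z hz1 hz2
  have e1 := hadd _ hz1 _ hy
  have e2 := hadd _ hx₀ _ hz2
  rw [show z + (x₀ - y) + y = x₀ + z by ring] at e1
  linarith

lemma ae_eq_Icc_of_hasDerivAt_massBelow {X : Set ℝ} (hm : MeasurableSet X) (hX : volume X ≠ ⊤)
    (h0 : 0 < volume.real X) (hd : ∀ x ∈ splitting X, HasDerivAt (massBelow X) 1 x) :
    ∃ c, X =ᵐ[volume] Icc (c - volume.real X / 2) (c + volume.real X / 2) := by
  obtain ⟨x₀, hx₀⟩ := exists_mem_splitting hX h0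
  set p := volume.real X with hp
  set κ := x₀ - massBelow X x₀ with hκ
  have hlin : ∀ x ∈ splitting X, massBelow X x = x - κ := by
    intro x hx
    have hconv : Convex ℝ (splitting X) := (ordConnected_splitting hX).convex
    have := (isOpen_splitting hX).is_const_of_deriv_eq_zero (f := fun x => massBelow X x - x)
      hconv.isPreconnected
      (fun z hz => ((hd z hz).sub (hasDerivAt_id z)).differentiableAt.differentiableWithinAt)
      (fun z hz => by
        have h1 := ((hd z hz).sub (hasDerivAt_id z)).deriv
        rw [sub_self] at h1
        exact h1) hx hx₀
    linarith
  have hsub : splitting X ⊆ Icc κ (κ + p) := fun x hx => by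
    have := hlin x hx
    constructor <;> linarith [hx.1, hx.2]
  have hle : X ≤ᵐ[volume] Icc κ (κ + p) := by
    have hn : volume (X \ Icc κ (κ + p)) = 0 := by
      have h1 : X \ Icc κ (κ + p) ⊆ X ∩ Iic κ ∪ X ∩ Ioi (κ + p) := by
        rintro z ⟨hz, hz2⟩
        rcases le_or_gt z κ with h | h
        · exact Or.inl ⟨hz, h⟩
        · refine Or.inr ⟨hz, ?_⟩
          by_contra hc
          exact hz2 ⟨h.le, not_lt.1 hc⟩
      have h2 : massBelow X κ = 0 := by
        by_contra hc
        have hκ0 : 0 < massBelow X κ := lt_of_le_of_ne (massBelow_nonneg _ _) (Ne.symm hc)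
        have : κ ∈ splitting X := ⟨hκ0, (massBelow_mono hX (hsub hx₀).1).trans_lt hx₀.2⟩
        have := hlin _ this
        linarith
      have h3 : massBelow X (κ + p) = p := by
        by_contra hc
        have hκ0 : massBelow X (κ + p) < p := lt_of_le_of_ne (massBelow_le hX _) hc
        have : κ + p ∈ splitting X := ⟨hx₀.1.trans_le (massBelow_mono hX (hsub hx₀).2), hκ0⟩
        have := hlin _ this
        linarith
      refine measure_mono_null h1 (measure_union_null ?_ ?_)
      · exact (measureReal_eq_zero_iff (measureReal_inter_ne_top hX _)).1 h2
      · refine (measureReal_eq_zero_iff (measureReal_inter_ne_top hX _)).1 ?_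
        rw [measureReal_inter_Ioi hX, h3, sub_self]
    exact ae_le_set.2 hn
  refine ⟨κ + p / 2, ?_⟩
  rw [show κ + p / 2 - p / 2 = κ by ring, show κ + p / 2 + p / 2 = κ + p by ring]
  refine ae_eq_of_ae_subset_of_measure_ge hle ?_ hm.nullMeasurableSet (by simp)
  rw [Real.volume_Icc, add_sub_cancel_left, hp, ofReal_measureReal hX]

/-- Equality in the one-dimensional Brunn-Minkowski inequality forces intervals. -/
lemma ae_eq_Icc_of_add {X Y A : Set ℝ} (hXm : MeasurableSet X) (hYm : MeasurableSet Y)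
    (hX : volume X ≠ ⊤) (hY : volume Y ≠ ⊤)
    (hA : volume A ≠ ⊤) (hX0 : 0 < volume.real X) (hY0 : 0 < volume.real Y)
    (h : ∀ᵐ q : ℝ × ℝ, q.1 ∈ X → q.2 ∈ Y → q.1 + q.2 ∈ A)
    (hle : volume.real A ≤ volume.real X + volume.real Y) :
    (∃ c, X =ᵐ[volume] Icc (c - volume.real X / 2) (c + volume.real X / 2)) ∧
    ∃ c, Y =ᵐ[volume] Icc (c - volume.real Y / 2) (c + volume.real Y / 2) := by
  have hadd : ∀ x ∈ splitting X, ∀ y ∈ splitting Y,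
      massBelow A (x + y) = massBelow X x + massBelow Y y := fun x hx y hy =>
    le_antisymm (le_massBelow_add hX hY hA h hle hx.2 hy.2) (massBelow_add_le hX hY hA h hx.1 hy.1)
  have hadd' : ∀ y ∈ splitting Y, ∀ x ∈ splitting X,
      massBelow A (y + x) = massBelow Y y + massBelow X x := fun y hy x hx => by
    rw [add_comm, hadd x hx y hy, add_comm]
  obtain ⟨x₀, hx₀, hdx⟩ := exists_hasDerivAt_massBelow hXm hX hX0
  obtain ⟨y₀, hy₀, hdy⟩ := exists_hasDerivAt_massBelow hYm hY hY0
  exact ⟨ae_eq_Icc_of_hasDerivAt_massBelow hXm hX hX0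
      fun x hx => hasDerivAt_massBelow_of_add hY hX hadd' hy₀ hdy hx,
    ae_eq_Icc_of_hasDerivAt_massBelow hYm hY hY0
      fun y hy => hasDerivAt_massBelow_of_add hX hY hadd hx₀ hdx hy⟩

section Profile

variable {ι : Type*}

/-- Upper end of the slice at height `t` of the strips `|τ + m i * t| ≤ b i`. -/
noncomputable def upperEnd (s : Finset ι) (hs : s.Nonempty) (m b : ι → ℝ) (t : ℝ) : ℝ :=
  s.inf' hs fun i => b i - m i * t

/-- Signed length of the slice at height `t` of the strips `|τ + m i * t| ≤ b i`. -/
noncomputable def sliceLen (s : Finset ι) (hs : s.Nonempty) (m b : ι → ℝ) (t : ℝ) : ℝ :=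
  upperEnd s hs m b t + upperEnd s hs m b (-t)

variable {s : Finset ι} {hs : s.Nonempty} {m b : ι → ℝ}

lemma upperEnd_le {i : ι} (hi : i ∈ s) (t : ℝ) : upperEnd s hs m b t ≤ b i - m i * t :=
  Finset.inf'_le _ hi

lemma mem_slice_iff {t τ : ℝ} :
    (∀ i ∈ s, |τ + m i * t| ≤ b i) ↔ τ ∈ Icc (-upperEnd s hs m b (-t)) (upperEnd s hs m b t) := by
  rw [mem_Icc, neg_le, upperEnd, upperEnd, Finset.le_inf'_iff, Finset.le_inf'_iff]
  constructor
  · intro h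
    exact ⟨fun i hi => by linarith [(abs_le.1 (h i hi)).1],
      fun i hi => by linarith [(abs_le.1 (h i hi)).2]⟩
  · rintro ⟨h1, h2⟩ i hi
    exact abs_le.2 ⟨by linarith [h1 i hi], by linarith [h2 i hi]⟩

lemma volume_slice (t : ℝ) :
    volume {τ : ℝ | ∀ i ∈ s, |τ + m i * t| ≤ b i} = ENNReal.ofReal (sliceLen s hs m b t) := by
  have : {τ : ℝ | ∀ i ∈ s, |τ + m i * t| ≤ b i} =
      Icc (-upperEnd s hs m b (-t)) (upperEnd s hs m b t) := by
    ext τ; exact mem_slice_iff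
  rw [this, Real.volume_Icc, sliceLen, sub_neg_eq_add]

lemma sliceLen_neg (t : ℝ) : sliceLen s hs m b (-t) = sliceLen s hs m b t := by
  simp only [sliceLen, neg_neg, add_comm]

lemma sliceLen_le {i : ι} (hi : i ∈ s) (t : ℝ) : sliceLen s hs m b t ≤ 2 * b i := by
  have h1 := upperEnd_le (hs := hs) (m := m) (b := b) hi t
  have h2 := upperEnd_le (hs := hs) (m := m) (b := b) hi (-t)
  unfold sliceLen; linarith

lemma sliceLen_le_zero (t : ℝ) : sliceLen s hs m b t ≤ sliceLen s hs m b 0 := by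
  obtain ⟨i, hi, h⟩ := s.exists_mem_eq_inf' hs fun i => b i - m i * 0
  have h1 := sliceLen_le (hs := hs) (m := m) (b := b) hi t
  have h2 : sliceLen s hs m b 0 = 2 * b i := by
    simp only [sliceLen, upperEnd, neg_zero, h]; ring
  linarith

lemma upperEnd_concave {θ : ℝ} (h0 : 0 ≤ θ) (h1 : θ ≤ 1) (a : ℝ) :
    (1 - θ) * upperEnd s hs m b 0 + θ * upperEnd s hs m b a ≤ upperEnd s hs m b (θ * a) := by
  conv_rhs => rw [upperEnd]
  refine Finset.le_inf' _ _ fun i hi => ?_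
  have e1 := upperEnd_le (hs := hs) (m := m) (b := b) hi 0
  have e2 := upperEnd_le (hs := hs) (m := m) (b := b) hi a
  have := mul_le_mul_of_nonneg_left e1 (sub_nonneg.2 h1)
  have := mul_le_mul_of_nonneg_left e2 h0
  linarith

lemma sliceLen_concave {θ : ℝ} (h0 : 0 ≤ θ) (h1 : θ ≤ 1) (a : ℝ) :
    (1 - θ) * sliceLen s hs m b 0 + θ * sliceLen s hs m b a ≤ sliceLen s hs m b (θ * a) := by
  have e1 := upperEnd_concave (s := s) (hs := hs) (m := m) (b := b) h0 h1 a
  have e2 := upperEnd_concave (s := s) (hs := hs) (m := m) (b := b) h0 h1 (-a)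
  simp only [sliceLen, neg_zero]
  rw [show -(θ * a) = θ * -a by ring]
  linarith

lemma sliceLen_abs (t : ℝ) : sliceLen s hs m b |t| = sliceLen s hs m b t := by
  rcases abs_choice t with h | h <;> rw [h]
  exact sliceLen_neg t

lemma sliceLen_anti {a t : ℝ} (h : |t| ≤ |a|) : sliceLen s hs m b a ≤ sliceLen s hs m b t := by
  rw [← sliceLen_abs a, ← sliceLen_abs t]
  rcases (abs_nonneg a).eq_or_lt with h0 | h0
  · rw [← h0] at h ⊢
    rw [le_antisymm h (abs_nonneg t)]
  · have h1 : |t| / |a| ≤ 1 := (div_le_one h0).2 h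
    have h2 := sliceLen_concave (s := s) (hs := hs) (m := m) (b := b)
      (div_nonneg (abs_nonneg t) h0.le) h1 |a|
    rw [div_mul_cancel₀ _ h0.ne'] at h2
    have h3 := sliceLen_le_zero (s := s) (hs := hs) (m := m) (b := b) |a|
    have := mul_le_mul_of_nonneg_left h3 (sub_nonneg.2 h1)
    linarith

lemma sliceLen_lt {a t : ℝ} (h : |t| < |a|) (h0 : sliceLen s hs m b a < sliceLen s hs m b 0) :
    sliceLen s hs m b a < sliceLen s hs m b t := by
  rw [← sliceLen_abs a] at h0 ⊢
  rw [← sliceLen_abs t]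
  have ha : 0 < |a| := (abs_nonneg t).trans_lt h
  have h1 : |t| / |a| < 1 := (div_lt_one ha).2 h
  have h2 := sliceLen_concave (s := s) (hs := hs) (m := m) (b := b)
      (div_nonneg (abs_nonneg t) ha.le) h1.le |a|
  rw [div_mul_cancel₀ _ ha.ne'] at h2
  have := mul_lt_mul_of_pos_left h0 (sub_pos.2 h1)
  linarith

lemma upperEnd_sub_const (d t : ℝ) :
    upperEnd s hs m (fun i => b i - d) t = upperEnd s hs m b t - d := by
  refine le_antisymm ?_ ?_
  · rw [le_sub_iff_add_le]
    refine Finset.le_inf' _ _ fun i hi => ?_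
    have := upperEnd_le (hs := hs) (m := m) (b := fun i => b i - d) hi t
    linarith
  · refine Finset.le_inf' _ _ fun i hi => ?_
    have := upperEnd_le (hs := hs) (m := m) (b := b) hi t
    linarith

lemma sliceLen_sub_const (d t : ℝ) :
    sliceLen s hs m (fun i => b i - d / 2) t = sliceLen s hs m b t - d := by
  simp only [sliceLen, upperEnd_sub_const]; ring

lemma exists_isUpperSet {F : Set ℝ} {p d : ℝ} (hF : volume F = ENNReal.ofReal p) (h0 : 0 ≤ d)
    (h1 : d ≤ p) :
    ∃ U : Set ℝ, IsUpperSet U ∧ MeasurableSet U ∧ volume (F ∩ U) = ENNReal.ofReal d := by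
  rcases h0.eq_or_lt with h0' | h0'
  · exact ⟨∅, isUpperSet_empty, MeasurableSet.empty, by simp [← h0']⟩
  rcases h1.eq_or_lt with h1' | h1'
  · exact ⟨univ, isUpperSet_univ, MeasurableSet.univ, by simp [hF, h1']⟩
  have hfin : volume F ≠ ⊤ := by simp [hF]
  have hr : volume.real F = p := by
    rw [measureReal_def, hF, ENNReal.toReal_ofReal (h0.trans h1)]
  obtain ⟨x, hx⟩ := exists_massBelow_eq hfin (d := p - d) (by linarith) (by linarith)
  refine ⟨Ioi x, isUpperSet_Ioi x, measurableSet_Ioi, ?_⟩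
  rw [← ofReal_measureReal (measureReal_inter_ne_top hfin _), measureReal_inter_Ioi hfin, hx, hr,
    sub_sub_cancel]

lemma volume_slice_le (hs : s.Nonempty) {F U : ι → Set ℝ} {d : ENNReal}
    (hU : ∀ i ∈ s, IsUpperSet (U i)) (hd : ∀ i ∈ s, volume (F i ∩ U i) ≤ d) (c : ι → ℝ) :
    volume {τ : ℝ | ∀ i ∈ s, τ + c i ∈ F i} ≤
      volume {τ : ℝ | ∀ i ∈ s, τ + c i ∈ F i \ U i} + d := by
  obtain ⟨i₀, hi₀, hmax⟩ : ∃ i₀ ∈ s, ∀ j ∈ s, ∀ τ, τ + c j ∈ U j → τ + c i₀ ∈ U i₀ := by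
    induction hs using Finset.Nonempty.cons_induction with
    | singleton i => exact ⟨i, by simp, by simp⟩
    | cons i s hi hs ih =>
      obtain ⟨i₀, hi₀, h⟩ := ih (fun j hj => hU j (Finset.mem_cons_of_mem hj))
        (fun j hj => hd j (Finset.mem_cons_of_mem hj))
      have u1 : IsUpperSet ((fun τ => τ + c i) ⁻¹' U i) := fun x y hxy hx =>
        hU i (Finset.mem_cons_self _ _) (by simpa using hxy) hx
      have u2 : IsUpperSet ((fun τ => τ + c i₀) ⁻¹' U i₀) := fun x y hxy hx =>
        hU i₀ (Finset.mem_cons_of_mem hi₀) (by simpa using hxy) hx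
      rcases u1.total u2 with h12 | h12
      · refine ⟨i₀, Finset.mem_cons_of_mem hi₀, fun j hj τ hτ => ?_⟩
        rcases Finset.mem_cons.1 hj with rfl | hj
        · exact h12 hτ
        · exact h j hj τ hτ
      · refine ⟨i, Finset.mem_cons_self _ _, fun j hj τ hτ => ?_⟩
        rcases Finset.mem_cons.1 hj with rfl | hj
        · exact hτ
        · exact h12 (h j hj τ hτ)
  calc volume {τ : ℝ | ∀ i ∈ s, τ + c i ∈ F i}
      ≤ volume ({τ : ℝ | ∀ i ∈ s, τ + c i ∈ F i \ U i} ∪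
          (fun τ => τ + c i₀) ⁻¹' (F i₀ ∩ U i₀)) := by
        refine measure_mono fun τ hτ => ?_
        by_cases h : τ + c i₀ ∈ U i₀
        · exact Or.inr ⟨hτ i₀ hi₀, h⟩
        · exact Or.inl fun i hi => ⟨hτ i hi, fun hc => h (hmax i hi τ hc)⟩
    _ ≤ _ := (measure_union_le _ _).trans (by
        gcongr
        rw [measure_preimage_add_right]
        exact hd i₀ hi₀)

end Profile

section Frame

lemma exists_frame {f : ℝ × ℝ →ₗ[ℝ] ℝ} (hf : Function.Surjective f) :
    ∃ w v : ℝ × ℝ, f w = 1 ∧ f v = 0 ∧ v ≠ 0 := by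
  obtain ⟨w, hw⟩ := hf 1
  refine ⟨w, (-f (0, 1), f (1, 0)), hw, ?_, fun h => ?_⟩
  · have : ((-f (0, 1), f (1, 0)) : ℝ × ℝ) =
        (-f (0, 1)) • ((1, 0) : ℝ × ℝ) + f (1, 0) • ((0, 1) : ℝ × ℝ) := by simp
    rw [this, map_add, map_smul, map_smul]; simp; ring
  · rw [Prod.mk_eq_zero, neg_eq_zero] at h
    have : w = w.1 • ((1, 0) : ℝ × ℝ) + w.2 • ((0, 1) : ℝ × ℝ) := by simp
    rw [this, map_add, map_smul, map_smul, h.1, h.2] at hw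
    simp at hw

/-- The linear map with columns `w` and `v`. -/
noncomputable def frameMap (w v : ℝ × ℝ) : ℝ × ℝ →ₗ[ℝ] ℝ × ℝ :=
  (LinearMap.fst ℝ ℝ ℝ).smulRight w + (LinearMap.snd ℝ ℝ ℝ).smulRight v

lemma frameMap_apply (w v q : ℝ × ℝ) : frameMap w v q = q.1 • w + q.2 • v := rfl

lemma det_ne_zero_of_injective {T : ℝ × ℝ →ₗ[ℝ] ℝ × ℝ} (h : ∀ x, T x = 0 → x = 0) :
    LinearMap.det T ≠ 0 := by
  intro hd
  obtain ⟨x, hx, hx0⟩ := (Submodule.ne_bot_iff _).1 (LinearMap.bot_lt_ker_of_det_eq_zero hd).ne'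
  exact hx0 (h x hx)

variable {f : ℝ × ℝ →ₗ[ℝ] ℝ} {w v : ℝ × ℝ}

lemma det_frameMap_ne_zero (hw : f w = 1) (hv : f v = 0) (hv0 : v ≠ 0) :
    LinearMap.det (frameMap w v) ≠ 0 := by
  refine det_ne_zero_of_injective fun q hq => ?_
  rw [frameMap_apply] at hq
  have h1 : q.1 = 0 := by
    have := congrArg f hq
    simpa [hw, hv] using this
  rw [h1, zero_smul, zero_add, smul_eq_zero] at hq
  exact Prod.ext h1 (hq.resolve_right hv0)

lemma exists_frame_coord (hw : f w = 1) (hv : f v = 0) (hv0 : v ≠ 0) (x : ℝ × ℝ) :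
    ∃ τ : ℝ, x = f x • w + τ • v := by
  have hsurj : Function.Surjective (frameMap w v) :=
    (LinearMap.equivOfDetNeZero _ (det_frameMap_ne_zero hw hv hv0)).surjective
  obtain ⟨q, rfl⟩ := hsurj x
  refine ⟨q.2, ?_⟩
  rw [frameMap_apply]; simp [hw, hv]

lemma volume_eq_lintegral_slices (hw : f w = 1) (hv : f v = 0) (hv0 : v ≠ 0) :
    ∃ C : ENNReal, C ≠ 0 ∧ C ≠ ⊤ ∧ ∀ S : Set (ℝ × ℝ), MeasurableSet S →
      volume S = C * ∫⁻ t : ℝ, volume {τ : ℝ | t • w + τ • v ∈ S} := by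
  have hd := det_frameMap_ne_zero hw hv hv0
  refine ⟨ENNReal.ofReal |LinearMap.det (frameMap w v)|, by simpa using hd, by simp,
    fun S hS => ?_⟩
  have h1 := Measure.addHaar_preimage_linearMap volume hd S
  have hm : Measurable (frameMap w v) := (LinearMap.continuous_of_finiteDimensional _).measurable
  rw [Measure.volume_eq_prod, Measure.prod_apply (hm hS), ← Measure.volume_eq_prod] at h1
  have h2 : ∀ t : ℝ, Prod.mk t ⁻¹' (frameMap w v ⁻¹' S) = {τ : ℝ | t • w + τ • v ∈ S} :=
    fun t => rfl
  simp only [h2] at h1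
  rw [h1, ← mul_assoc, ← ENNReal.ofReal_mul (abs_nonneg _), abs_inv,
    mul_inv_cancel₀ (abs_ne_zero.2 hd), ENNReal.ofReal_one, one_mul]

end Frame

section Region

variable {ι : Type*}

/-- The set of points whose images under `L i` lie in `E i` for all `i ∈ s`. -/
def region (L : ι → (ℝ × ℝ →ₗ[ℝ] ℝ)) (s : Finset ι) (E : ι → Set ℝ) : Set (ℝ × ℝ) :=
  {x | ∀ i ∈ s, L i x ∈ E i}

/-- The intersection of the strips `|L i x| ≤ a i` over `i ∈ s`. -/
def polygon (L : ι → (ℝ × ℝ →ₗ[ℝ] ℝ)) (s : Finset ι) (a : ι → ℝ) : Set (ℝ × ℝ) :=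
  {x | ∀ i ∈ s, |L i x| ≤ a i}

/-- Slope of the strip of `L i` in the frame `w, v`. -/
noncomputable def slope (L : ι → (ℝ × ℝ →ₗ[ℝ] ℝ)) (w v : ℝ × ℝ) (i : ι) : ℝ := L i w / L i v

/-- Half of the length of the intersection of the strip of `L i` with a line of direction `v`. -/
noncomputable def halfLen (L : ι → (ℝ × ℝ →ₗ[ℝ] ℝ)) (v : ℝ × ℝ) (a : ι → ℝ) (i : ι) : ℝ :=
  a i / |L i v|

/-- The half-widths of the strips after moving their sides by `d / 2` in the direction `v`. -/
noncomputable def shrink (L : ι → (ℝ × ℝ →ₗ[ℝ] ℝ)) (v : ℝ × ℝ) (d : ℝ) (a : ι → ℝ) (i : ι) : ℝ :=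
  a i - |L i v| * (d / 2)

/-- The part of `E i` remaining after removal of a scaled copy of `U i`. -/
def truncate (L : ι → (ℝ × ℝ →ₗ[ℝ] ℝ)) (v : ℝ × ℝ) (U E : ι → Set ℝ) (i : ι) : Set ℝ :=
  {x | x ∈ E i ∧ x / L i v ∉ U i}

variable {L : ι → (ℝ × ℝ →ₗ[ℝ] ℝ)} {s : Finset ι} {hs : s.Nonempty} {w v : ℝ × ℝ} {a : ι → ℝ}
  {E : ι → Set ℝ} {k : ι}

lemma measurable_form (f : ℝ × ℝ →ₗ[ℝ] ℝ) : Measurable f :=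
  (LinearMap.continuous_of_finiteDimensional f).measurable

lemma measurableSet_region (hE : ∀ i ∈ s, MeasurableSet (E i)) :
    MeasurableSet (region L s E) := by
  have : region L s E = ⋂ i ∈ s, L i ⁻¹' E i := by ext x; simp [region]
  rw [this]
  exact Finset.measurableSet_biInter _ fun i hi => measurable_form _ (hE i hi)

lemma polygon_eq_region : polygon L s a = region L s fun i => Icc (-a i) (a i) := by
  ext x; simp [polygon, region, abs_le]

lemma measurableSet_polygon : MeasurableSet (polygon L s a) := by
  rw [polygon_eq_region]
  exact measurableSet_region fun i _ => measurableSet_Icc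

lemma halfLen_mul {i : ι} (hi : L i v ≠ 0) : |L i v| * halfLen L v a i = a i := by
  rw [halfLen, mul_div_cancel₀ _ (abs_ne_zero.2 hi)]

lemma form_smul_add_smul {i : ι} (hi : L i v ≠ 0) (t τ : ℝ) :
    L i (t • w + τ • v) = L i v * (τ + slope L w v i * t) := by
  rw [map_add, map_smul, map_smul, slope, smul_eq_mul, smul_eq_mul]
  field_simp
  ring

lemma abs_form_le_iff {i : ι} (hi : L i v ≠ 0) (t τ : ℝ) :
    |L i (t • w + τ • v)| ≤ a i ↔ |τ + slope L w v i * t| ≤ halfLen L v a i := by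
  rw [form_smul_add_smul hi, abs_mul, halfLen, le_div_iff₀ (abs_pos.2 hi), mul_comm]

lemma smul_add_smul_mem_polygon_iff (hc : ∀ i ∈ s, L i v ≠ 0) (t τ : ℝ) :
    t • w + τ • v ∈ polygon L s a ↔
      τ ∈ Icc (-upperEnd s hs (slope L w v) (halfLen L v a) (-t))
        (upperEnd s hs (slope L w v) (halfLen L v a) t) := by
  rw [← mem_slice_iff]
  exact forall₂_congr fun i hi => abs_form_le_iff (hc i hi) t τ

lemma volume_polygon_slice (hc : ∀ i ∈ s, L i v ≠ 0) (t : ℝ) :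
    volume {τ : ℝ | t • w + τ • v ∈ polygon L s a} =
      ENNReal.ofReal (sliceLen s hs (slope L w v) (halfLen L v a) t) := by
  rw [← volume_slice]
  congr 1
  ext τ
  exact forall₂_congr fun i hi => abs_form_le_iff (hc i hi) t τ

lemma halfLen_shrink {i : ι} (hi : L i v ≠ 0) (d : ℝ) :
    halfLen L v (shrink L v d a) i = halfLen L v a i - d / 2 := by
  have := abs_ne_zero.2 hi
  rw [halfLen, halfLen, shrink]
  field_simp

lemma sliceLen_shrink (hc : ∀ i ∈ s, L i v ≠ 0) (d t : ℝ) :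
    sliceLen s hs (slope L w v) (halfLen L v (shrink L v d a)) t =
      sliceLen s hs (slope L w v) (halfLen L v a) t - d := by
  rw [← sliceLen_sub_const]
  have (t : ℝ) : upperEnd s hs (slope L w v) (halfLen L v (shrink L v d a)) t =
      upperEnd s hs (slope L w v) (fun i => halfLen L v a i - d / 2) t :=
    Finset.inf'_congr hs rfl fun i hi => by rw [halfLen_shrink (hc i hi)]
  simp only [sliceLen, this]

lemma upperEnd_shrink (hc : ∀ i ∈ s, L i v ≠ 0) (d t : ℝ) :
    upperEnd s hs (slope L w v) (halfLen L v (shrink L v d a)) t =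
      upperEnd s hs (slope L w v) (halfLen L v a) t - d / 2 := by
  rw [← upperEnd_sub_const]
  exact Finset.inf'_congr hs rfl fun i hi => by rw [halfLen_shrink (hc i hi)]

lemma volume_scaled {i : ι} (hi : L i v ≠ 0) (h : volume (E i) = ENNReal.ofReal (2 * a i)) :
    volume ((fun y => L i v * y) ⁻¹' E i) = ENNReal.ofReal (2 * halfLen L v a i) := by
  rw [Real.volume_preimage_mul_left hi, h, ← ENNReal.ofReal_mul (abs_nonneg _), abs_inv, halfLen]
  congr 1; ring

lemma volume_truncate {U : ι → Set ℝ} {i : ι} {d : ℝ} (hi : L i v ≠ 0) (hd : 0 ≤ d)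
    (hU : MeasurableSet (U i)) (h : volume (E i) = ENNReal.ofReal (2 * a i))
    (hEU : volume ((fun y => L i v * y) ⁻¹' E i ∩ U i) = ENNReal.ofReal d) :
    volume (truncate L v U E i) = ENNReal.ofReal (2 * shrink L v d a i) := by
  have h1 := volume_scaled hi h
  have h2 := measure_inter_add_sdiff (μ := volume) ((fun y => L i v * y) ⁻¹' E i) hU
  have h3 : (fun y => L i v * y) ⁻¹' E i \ U i =
      (fun y => L i v * y) ⁻¹' truncate L v U E i := by
    ext y; simp [truncate, hi]
  rw [h3, hEU, h1, Real.volume_preimage_mul_left hi] at h2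
  have h4 : ENNReal.ofReal |(L i v)⁻¹| * volume (truncate L v U E i) =
      ENNReal.ofReal (2 * halfLen L v a i - d) := by
    rw [ENNReal.ofReal_sub _ hd, ← h2, ENNReal.add_sub_cancel_left ENNReal.ofReal_ne_top]
  calc volume (truncate L v U E i)
      = ENNReal.ofReal |L i v| * (ENNReal.ofReal |(L i v)⁻¹| * volume (truncate L v U E i)) := by
        rw [← mul_assoc, ← ENNReal.ofReal_mul (abs_nonneg _), ← abs_mul, mul_inv_cancel₀ hi]; simp
    _ = ENNReal.ofReal (2 * shrink L v d a i) := by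
        rw [h4, ← ENNReal.ofReal_mul (abs_nonneg _)]
        congr 1
        have := halfLen_mul (a := a) hi
        rw [shrink]; linarith

lemma measurableSet_truncate {U : ι → Set ℝ} {i : ι} (hE : MeasurableSet (E i))
    (hU : MeasurableSet (U i)) : MeasurableSet (truncate L v U E i) :=
  hE.inter ((measurable_id.div_const (L i v)) hU).compl

/-- Removing the parts of the sets cut off by translating strips in the direction `ker (L k)`
eliminates the constraint `k`. -/
lemma exists_truncate [DecidableEq ι] (hw : L k w = 1) (hv : L k v = 0) (hv0 : v ≠ 0)
    (hc : ∀ i ∈ s, L i v ≠ 0) (hE : ∀ i ∈ insert k s, MeasurableSet (E i))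
    (ha : ∀ i ∈ insert k s, 0 ≤ a i)
    (hEa : ∀ i ∈ insert k s, volume (E i) = ENNReal.ofReal (2 * a i)) {d : ℝ}
    (hd : d = max (sliceLen s hs (slope L w v) (halfLen L v a) (a k)) 0) :
    ∃ U : ι → Set ℝ, ∃ C : ENNReal, C ≠ ⊤ ∧ (∀ i ∈ s, IsUpperSet (U i)) ∧
      (∀ i ∈ s, MeasurableSet (U i)) ∧
      (∀ i ∈ s, volume (truncate L v U E i) = ENNReal.ofReal (2 * shrink L v d a i)) ∧
      volume (region L (insert k s) E) ≤
        volume (region L s (truncate L v U E) ∩ L k ⁻¹' E k) + C ∧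
      volume (polygon L (insert k s) a) = volume (polygon L s (shrink L v d a)) + C := by
  have hd0 : 0 ≤ d := hd ▸ le_max_right _ _
  have hhalf : ∀ i ∈ s, 0 ≤ halfLen L v a i := fun i hi =>
    div_nonneg (ha i (Finset.mem_insert_of_mem hi)) (abs_nonneg _)
  have hU : ∀ i, ∃ U : Set ℝ, i ∈ s → IsUpperSet U ∧ MeasurableSet U ∧
      volume ((fun y => L i v * y) ⁻¹' E i ∩ U) = ENNReal.ofReal d := by
    intro i
    by_cases hi : i ∈ s
    · obtain ⟨U, hU⟩ := exists_isUpperSet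
        (volume_scaled (hc i hi) (hEa i (Finset.mem_insert_of_mem hi))) hd0
        (hd ▸ max_le (sliceLen_le hi _) (by linarith [hhalf i hi]))
      exact ⟨U, fun _ => hU⟩
    · exact ⟨∅, fun h => absurd h hi⟩
  choose U hU using hU
  obtain ⟨C, hC0, hCtop, hC⟩ := volume_eq_lintegral_slices hw hv hv0
  have hLk : ∀ t τ : ℝ, L k (t • w + τ • v) = t := fun t τ => by simp [hw, hv]
  refine ⟨U, C * (ENNReal.ofReal d * ENNReal.ofReal (2 * a k)),
    ENNReal.mul_ne_top hCtop (by finiteness), fun i hi => (hU i hi).1, fun i hi => (hU i hi).2.1,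
    fun i hi => volume_truncate (hc i hi) hd0 (hU i hi).2.1
      (hEa i (Finset.mem_insert_of_mem hi)) (hU i hi).2.2, ?_, ?_⟩
  · have hmk := hE k (Finset.mem_insert_self _ _)
    rw [hC _ (measurableSet_region hE), hC _ ((measurableSet_region fun i hi =>
      measurableSet_truncate (hE i (Finset.mem_insert_of_mem hi)) (hU i hi).2.1).inter
        (measurable_form _ hmk)), ← mul_add]
    gcongr
    rw [← hEa k (Finset.mem_insert_self _ _), ← lintegral_indicator_const hmk,
      ← lintegral_add_right _ (measurable_const.indicator hmk)]
    refine lintegral_mono fun t => ?_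
    by_cases ht : t ∈ E k
    · rw [indicator_of_mem ht]
      have h1 := volume_slice_le hs (F := fun i => (fun y => L i v * y) ⁻¹' E i) (U := U)
        (fun i hi => (hU i hi).1) (fun i hi => (hU i hi).2.2.le) (fun i => slope L w v i * t)
      convert h1 using 2
      · congr 1
        ext τ
        simp only [mem_ofPred_eq, region, Finset.forall_mem_insert, hLk, ht, true_and]
        exact forall₂_congr fun i hi => by rw [form_smul_add_smul (hc i hi)]; rfl
      · congr 1
        ext τ
        simp only [mem_ofPred_eq, region, mem_inter_iff, mem_preimage, hLk, ht, and_true]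
        refine forall₂_congr fun i hi => ?_
        rw [form_smul_add_smul (hc i hi), truncate, mem_ofPred_eq,
          mul_div_cancel_left₀ _ (hc i hi)]
        rfl
    · have : {τ : ℝ | t • w + τ • v ∈ region L (insert k s) E} = ∅ := by
        ext τ
        simp [region, hLk, ht]
      rw [this]; simp
  · rw [hC _ measurableSet_polygon, hC _ measurableSet_polygon, ← mul_add]
    congr 1
    have : ENNReal.ofReal (2 * a k) = volume (Icc (-a k) (a k)) := by
      rw [Real.volume_Icc]; congr 1; ring
    rw [this, ← lintegral_indicator_const measurableSet_Icc,
      ← lintegral_add_right _ (measurable_const.indicator measurableSet_Icc)]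
    refine lintegral_congr fun t => ?_
    rw [volume_polygon_slice (hs := hs) hc, sliceLen_shrink hc]
    by_cases ht : |t| ≤ a k
    · rw [indicator_of_mem (show t ∈ Icc (-a k) (a k) from abs_le.1 ht)]
      have h1 : {τ : ℝ | t • w + τ • v ∈ polygon L (insert k s) a} =
          {τ : ℝ | t • w + τ • v ∈ polygon L s a} := by
        ext τ
        simp only [mem_ofPred_eq, polygon, Finset.forall_mem_insert, hLk, ht, true_and]
      rw [h1, volume_polygon_slice (hs := hs) hc]
      have h2 := sliceLen_anti (s := s) (hs := hs) (m := slope L w v) (b := halfLen L v a)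
        (ht.trans (le_abs_self _))
      rcases le_or_gt (sliceLen s hs (slope L w v) (halfLen L v a) (a k)) 0 with h3 | h3
      · rw [hd, max_eq_right h3]; simp
      · rw [hd, max_eq_left h3.le, ← ENNReal.ofReal_add (by linarith) h3.le, sub_add_cancel]
    · rw [indicator_of_notMem (show t ∉ Icc (-a k) (a k) from fun h => ht (abs_le.2 h)), add_zero]
      have h1 : {τ : ℝ | t • w + τ • v ∈ polygon L (insert k s) a} = ∅ := by
        ext τ
        simp [polygon, hLk, ht]
      have h2 := sliceLen_anti (s := s) (hs := hs) (m := slope L w v) (b := halfLen L v a)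
        (a := t) (t := a k)
        (by rw [abs_of_nonneg (ha k (Finset.mem_insert_self _ _))]; exact (not_le.1 ht).le)
      have h3 : sliceLen s hs (slope L w v) (halfLen L v a) (a k) ≤ d := hd ▸ le_max_left _ _
      rw [h1, measure_empty, ENNReal.ofReal_of_nonpos (by linarith)]

end Region

section Inequality

variable {ι : Type*} {L : ι → (ℝ × ℝ →ₗ[ℝ] ℝ)} {s : Finset ι} {hs : s.Nonempty} {w v : ℝ × ℝ}
  {a : ι → ℝ} {E : ι → Set ℝ} {k : ι}

lemma shrink_nonneg {i : ι} (hi : i ∈ s) (hc : L i v ≠ 0) (ha : 0 ≤ a i) (t : ℝ) :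
    0 ≤ shrink L v (max (sliceLen s hs (slope L w v) (halfLen L v a) t) 0) a i := by
  have h0 : 0 ≤ halfLen L v a i := div_nonneg ha (abs_nonneg _)
  have h1 : max (sliceLen s hs (slope L w v) (halfLen L v a) t) 0 ≤ 2 * halfLen L v a i :=
    max_le (sliceLen_le hi _) (by linarith)
  have h2 := halfLen_mul (a := a) hc
  have := mul_le_mul_of_nonneg_left h1 (abs_nonneg (L i v))
  rw [shrink]; linarith

lemma form_ne_zero (hnd : ∀ i j, i ≠ j → ∀ x, L i x = 0 → L j x = 0 → x = 0) (hks : k ∉ s)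
    (hv : L k v = 0) (hv0 : v ≠ 0) : ∀ i ∈ s, L i v ≠ 0 := fun i hi h =>
  hv0 (hnd i k (fun hik => hks (hik ▸ hi)) v h hv)

lemma volume_preimage_form {f : ℝ × ℝ →ₗ[ℝ] ℝ} (hf : Function.Surjective f) :
    ∃ C : ENNReal, ∀ S : Set ℝ, MeasurableSet S → volume (f ⁻¹' S) = C * volume S := by
  obtain ⟨w, v, hw, hv, hv0⟩ := exists_frame hf
  obtain ⟨C, -, -, hC⟩ := volume_eq_lintegral_slices hw hv hv0
  refine ⟨C * ⊤, fun S hS => ?_⟩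
  rw [hC _ (measurable_form f hS), mul_assoc, ← lintegral_indicator_const hS]
  congr 1
  refine lintegral_congr fun t => ?_
  by_cases ht : t ∈ S <;> simp [hw, hv, ht]

/-- The Brascamp-Lieb-Luttinger inequality for sets, with two-dimensional domain. -/
lemma volume_region_le (hsurj : ∀ i, Function.Surjective (L i))
    (hnd : ∀ i j, i ≠ j → ∀ x, L i x = 0 → L j x = 0 → x = 0) (hs : s.Nonempty) :
    ∀ {a : ι → ℝ} {E : ι → Set ℝ}, (∀ i ∈ s, MeasurableSet (E i)) → (∀ i ∈ s, 0 ≤ a i) →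
      (∀ i ∈ s, volume (E i) = ENNReal.ofReal (2 * a i)) →
      volume (region L s E) ≤ volume (polygon L s a) := by
  classical
  induction hs using Finset.Nonempty.cons_induction with
  | singleton k =>
    intro a E hE ha hEa
    obtain ⟨C, hC⟩ := volume_preimage_form (hsurj k)
    have e1 : region L {k} E = L k ⁻¹' E k := by ext x; simp [region]
    have e2 : polygon L {k} a = L k ⁻¹' Icc (-a k) (a k) := by ext x; simp [polygon, abs_le]
    rw [e1, e2, hC _ (hE k (by simp)), hC _ measurableSet_Icc, hEa k (by simp), Real.volume_Icc,
      sub_neg_eq_add, two_mul]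
  | cons k s hk hs ih =>
    intro a E hE ha hEa
    rw [Finset.cons_eq_insert] at *
    obtain ⟨w, v, hw, hv, hv0⟩ := exists_frame (hsurj k)
    have hc := form_ne_zero hnd hk hv hv0
    obtain ⟨U, C, -, -, hUm, hU, h1, h2⟩ := exists_truncate (hs := hs) hw hv hv0 hc hE ha hEa rfl
    rw [h2]
    refine h1.trans (add_le_add ?_ le_rfl)
    exact (measure_mono inter_subset_left).trans (ih
      (fun i hi => measurableSet_truncate (hE i (Finset.mem_insert_of_mem hi)) (hUm i hi))
      (fun i hi => shrink_nonneg hi (hc i hi) (ha i (Finset.mem_insert_of_mem hi)) _) hU)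

lemma volume_polygon_ne_top (hsurj : ∀ i, Function.Surjective (L i))
    (hnd : ∀ i j, i ≠ j → ∀ x, L i x = 0 → L j x = 0 → x = 0) (hs : s.Nontrivial) :
    volume (polygon L s a) ≠ ⊤ := by
  obtain ⟨k, hk, j, hj, hkj⟩ := hs
  obtain ⟨w, v, hw, hv, hv0⟩ := exists_frame (hsurj k)
  have hc : ∀ i ∈ ({j} : Finset ι), L i v ≠ 0 :=
    form_ne_zero hnd (by simpa using hkj) hv hv0
  obtain ⟨C, -, hCtop, hC⟩ := volume_eq_lintegral_slices hw hv hv0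
  rw [hC _ measurableSet_polygon]
  refine ENNReal.mul_ne_top hCtop (ne_top_of_le_ne_top (b := ENNReal.ofReal (2 * halfLen L v a j) *
    volume (Icc (-a k) (a k))) (by simp [ENNReal.mul_ne_top]) ?_)
  rw [← lintegral_indicator_const measurableSet_Icc]
  refine lintegral_mono fun t => ?_
  by_cases ht : t ∈ Icc (-a k) (a k)
  · rw [indicator_of_mem ht]
    refine (measure_mono fun τ (hτ : t • w + τ • v ∈ polygon L s a) => ?_ : _ ≤
      volume {τ : ℝ | t • w + τ • v ∈ polygon L {j} a}).trans ?_
    · change t • w + τ • v ∈ polygon L {j} a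
      simpa [polygon] using hτ j hj
    · rw [volume_polygon_slice (hs := Finset.singleton_nonempty j) hc]
      exact ENNReal.ofReal_le_ofReal (sliceLen_le (Finset.mem_singleton_self j) t)
  · rw [indicator_of_notMem ht, nonpos_iff_eq_zero]
    convert measure_empty (μ := volume)
    ext τ
    simp only [mem_ofPred_eq, mem_empty_iff_false, iff_false]
    intro h
    have := h k hk
    rw [map_add, map_smul, map_smul, hw, hv] at this
    exact ht (abs_le.1 (by simpa using this))

/-- In the equality case, truncation leads again to an equality, and the eliminated constraint
holds automatically. -/
lemma exists_truncate_of_volume_eq [DecidableEq ι] (hsurj : ∀ i, Function.Surjective (L i))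
    (hnd : ∀ i j, i ≠ j → ∀ x, L i x = 0 → L j x = 0 → x = 0) (hst : s.Nontrivial) (hks : k ∉ s)
    (hw : L k w = 1) (hv : L k v = 0) (hv0 : v ≠ 0)
    (hE : ∀ i ∈ insert k s, MeasurableSet (E i)) (ha : ∀ i ∈ insert k s, 0 ≤ a i)
    (hEa : ∀ i ∈ insert k s, volume (E i) = ENNReal.ofReal (2 * a i))
    (heq : volume (region L (insert k s) E) = volume (polygon L (insert k s) a)) {d : ℝ}
    (hd : d = max (sliceLen s hs (slope L w v) (halfLen L v a) (a k)) 0) :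
    ∃ U : ι → Set ℝ, (∀ i ∈ s, IsUpperSet (U i)) ∧ (∀ i ∈ s, MeasurableSet (U i)) ∧
      (∀ i ∈ s, volume (truncate L v U E i) = ENNReal.ofReal (2 * shrink L v d a i)) ∧
      volume (region L s (truncate L v U E)) = volume (polygon L s (shrink L v d a)) ∧
      ∀ᵐ x, x ∈ region L s (truncate L v U E) → L k x ∈ E k := by
  have hc := form_ne_zero hnd hks hv hv0
  obtain ⟨U, C, hC, hUu, hUm, hU, h1, h2⟩ := exists_truncate (hs := hs) hw hv hv0 hc hE ha hEa hd
  have hEm : ∀ i ∈ s, MeasurableSet (truncate L v U E i) := fun i hi =>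
    measurableSet_truncate (hE i (Finset.mem_insert_of_mem hi)) (hUm i hi)
  have h3 := volume_region_le hsurj hnd hs hEm (a := shrink L v d a)
    (fun i hi => hd ▸ shrink_nonneg hi (hc i hi) (ha i (Finset.mem_insert_of_mem hi)) _) hU
  rw [heq, h2] at h1
  have h4 : volume (polygon L s (shrink L v d a)) ≤
      volume (region L s (truncate L v U E) ∩ L k ⁻¹' E k) :=
    (ENNReal.add_le_add_iff_right hC).1 h1
  refine ⟨U, hUu, hUm, hU, le_antisymm h3 (h4.trans (measure_mono inter_subset_left)), ?_⟩
  have h5 : volume (region L s (truncate L v U E) \ L k ⁻¹' E k) = 0 := by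
    have h6 := measure_inter_add_sdiff (μ := volume) (region L s (truncate L v U E))
      (measurable_form (L k) (hE k (Finset.mem_insert_self _ _)))
    have hfin : volume (region L s (truncate L v U E) ∩ L k ⁻¹' E k) ≠ ⊤ :=
      ne_top_of_le_ne_top (volume_polygon_ne_top hsurj hnd hst)
        ((measure_mono inter_subset_left).trans h3)
    refine (ENNReal.add_right_inj hfin).1 ?_
    rw [h6, add_zero]
    exact le_antisymm (h3.trans h4) (measure_mono inter_subset_left)
  exact ae_le_set.2 h5

end Inequality

section Intervals

lemma ae_eq_Icc_preimage_mul {X : Set ℝ} {c m r : ℝ} (hc : c ≠ 0)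
    (h : X =ᵐ[volume] Icc (m - r) (m + r)) :
    (fun y => c * y) ⁻¹' X =ᵐ[volume] Icc (m / c - r / |c|) (m / c + r / |c|) := by
  have hq : Measure.QuasiMeasurePreserving (fun y : ℝ => c * y) volume volume := by
    refine ⟨measurable_const_mul c, ?_⟩
    rw [Real.map_volume_mul_left hc]
    exact Measure.smul_absolutelyContinuous
  have h1 := hq.preimage_ae_eq h
  have h2 : Icc (m / c - r / |c|) (m / c + r / |c|) = (fun y => c * y) ⁻¹' Icc (m - r) (m + r) := by
    ext y
    rw [mem_preimage, ← Real.closedBall_eq_Icc, ← Real.closedBall_eq_Icc, Metric.mem_closedBall,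
      Metric.mem_closedBall, Real.dist_eq, Real.dist_eq, le_div_iff₀ (abs_pos.2 hc), ← abs_mul,
      sub_mul, div_mul_cancel₀ _ hc, mul_comm y]
  rwa [h2]

lemma ae_eq_Icc_of_preimage_mul {X : Set ℝ} {c m r : ℝ} (hc : c ≠ 0)
    (h : (fun y => c * y) ⁻¹' X =ᵐ[volume] Icc (m - r) (m + r)) :
    X =ᵐ[volume] Icc (c * m - |c| * r) (c * m + |c| * r) := by
  have := ae_eq_Icc_preimage_mul (inv_ne_zero hc) h
  rw [div_inv_eq_mul, abs_inv, div_inv_eq_mul, mul_comm m, mul_comm r] at this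
  have h2 : X = (fun y => c⁻¹ * y) ⁻¹' ((fun y => c * y) ⁻¹' X) := by ext y; simp [hc]
  rwa [h2]

lemma exists_mem_Ioo_of_ae {x y : ℝ} (hxy : x < y) {p : ℝ → Prop} (h : ∀ᵐ t, p t) :
    ∃ t ∈ Ioo x y, p t :=
  exists_mem_of_ae (by simpa using hxy) (h.mono fun _ ht _ => ht)

/-- Removing an upper set from an interval leaves the left endpoint unchanged. -/
lemma left_endpoint_eq {F U : Set ℝ} {x y x' y' : ℝ} (hU : IsUpperSet U)
    (hF : F =ᵐ[volume] Icc x y) (hFU : (F \ U : Set ℝ) =ᵐ[volume] Icc x' y') (h : x' < y') :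
    x = x' := by
  have hF' : ∀ᵐ t, t ∈ F ↔ t ∈ Icc x y := hF.mem_iff
  have hFU' : ∀ᵐ t, t ∈ F \ U ↔ t ∈ Icc x' y' := hFU.mem_iff
  refine le_antisymm ?_ ?_ <;> by_contra! hlt
  · obtain ⟨t, ht, h1, h2⟩ := exists_mem_Ioo_of_ae (lt_min h hlt) (hF'.and hFU')
    have h3 := h1.1 (h2.2 ⟨ht.1.le, ht.2.le.trans (min_le_left _ _)⟩).1
    exact absurd h3.1 (not_le.2 (ht.2.trans_le (min_le_right _ _)))
  · have hxy : x < y := by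
      obtain ⟨t, ht, h1, h2⟩ := exists_mem_Ioo_of_ae h (hF'.and hFU')
      have h3 := h1.1 (h2.2 ⟨ht.1.le, ht.2.le⟩).1
      linarith [h3.2, ht.1]
    obtain ⟨t, ht, h1, h2⟩ := exists_mem_Ioo_of_ae (lt_min hxy hlt) (hF'.and hFU')
    have htF := h1.2 ⟨ht.1.le, ht.2.le.trans (min_le_left _ _)⟩
    have htU : t ∈ U := by
      by_contra hc
      exact absurd (h2.1 ⟨htF, hc⟩).1 (not_le.2 (ht.2.trans_le (min_le_right _ _)))
    obtain ⟨u, hu, h4⟩ := exists_mem_Ioo_of_ae h hFU'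
    refine (h4.2 ⟨hu.1.le, hu.2.le⟩).2 (hU ?_ htU)
    exact ((ht.2.trans_le (min_le_right _ _)).trans hu.1).le

end Intervals

section Forms

variable {f g h : ℝ × ℝ →ₗ[ℝ] ℝ}

lemma ae_form (hf : Function.Surjective f) {p : ℝ → Prop} (hp : ∀ᵐ t, p t) :
    ∀ᵐ x, p (f x) := by
  obtain ⟨C, hC⟩ := volume_preimage_form hf
  rw [ae_iff] at hp ⊢
  refine measure_mono_null (preimage_mono (f := f) (subset_toMeasurable volume {t | ¬p t})) ?_
  rw [hC _ (measurableSet_toMeasurable _ _), measure_toMeasurable, hp, mul_zero]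

lemma exists_dual (hfg : ∀ x, f x = 0 → g x = 0 → x = 0) (c d : ℝ) :
    ∃ z, f z = c ∧ g z = d := by
  have hdet : LinearMap.det (f.prod g) ≠ 0 := det_ne_zero_of_injective fun x hx => by
    have hx' : (f x, g x) = 0 := hx
    exact hfg x (congrArg Prod.fst hx') (congrArg Prod.snd hx')
  obtain ⟨z, hz⟩ := (LinearMap.equivOfDetNeZero _ hdet).surjective (c, d)
  have hz' : (f z, g z) = (c, d) := hz
  exact ⟨z, congrArg Prod.fst hz', congrArg Prod.snd hz'⟩

/-- The equality case for three forms, reduced to two sets. -/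
lemma ae_eq_Icc_of_three_forms (hfg : ∀ x, f x = 0 → g x = 0 → x = 0)
    (hfh : ∀ x, f x = 0 → h x = 0 → x = 0) (hgh : ∀ x, g x = 0 → h x = 0 → x = 0)
    {X Y A : Set ℝ} {p q r : ℝ} (hp : 0 < p) (hq : 0 < q) (hr : 0 ≤ r)
    (hXm : MeasurableSet X) (hYm : MeasurableSet Y) (hX : volume X = ENNReal.ofReal (2 * p))
    (hY : volume Y = ENNReal.ofReal (2 * q)) (hA : volume A = ENNReal.ofReal (2 * r))
    (hae : ∀ᵐ x, f x ∈ X → g x ∈ Y → h x ∈ A)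
    (htight : ∃ x, |f x| ≤ p ∧ |g x| ≤ q ∧ h x = r) :
    ∃ z, X =ᵐ[volume] Icc (f z - p) (f z + p) ∧ Y =ᵐ[volume] Icc (g z - q) (g z + q) := by
  obtain ⟨z₁, hf₁, hg₁⟩ := exists_dual hfg 1 0
  obtain ⟨z₂, hf₂, hg₂⟩ := exists_dual hfg 0 1
  set α := h z₁ with hα
  set β := h z₂ with hβ
  have hα0 : α ≠ 0 := fun h0 => by
    rw [hgh z₁ hg₁ h0, map_zero] at hf₁; exact zero_ne_one hf₁
  have hβ0 : β ≠ 0 := fun h0 => by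
    rw [hfh z₂ hf₂ h0, map_zero] at hg₂; exact zero_ne_one hg₂
  have hdec : ∀ x, h x = f x * α + g x * β := fun x => by
    have : x - (f x • z₁ + g x • z₂) = 0 := hfg _ (by simp [hf₁, hf₂]) (by simp [hg₁, hg₂])
    conv_lhs => rw [sub_eq_zero.1 this]
    simp [hα, hβ]
  set T := frameMap (α⁻¹ • z₁) (β⁻¹ • z₂) with hT
  have hfT : ∀ q, f (T q) = α⁻¹ * q.1 := fun q => by
    rw [hT, frameMap_apply]; simp [hf₁, hf₂, mul_comm]
  have hgT : ∀ q, g (T q) = β⁻¹ * q.2 := fun q => by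
    rw [hT, frameMap_apply]; simp [hg₁, hg₂, mul_comm]
  have hdet : LinearMap.det T ≠ 0 := det_ne_zero_of_injective fun q hq => by
    have e1 := hfT q
    have e2 := hgT q
    rw [hq, map_zero, eq_comm, mul_eq_zero] at e1 e2
    exact Prod.ext (e1.resolve_left (inv_ne_zero hα0)) (e2.resolve_left (inv_ne_zero hβ0))
  have hae' : ∀ᵐ q : ℝ × ℝ, q.1 ∈ (fun y => α⁻¹ * y) ⁻¹' X → q.2 ∈ (fun y => β⁻¹ * y) ⁻¹' Y →
      q.1 + q.2 ∈ A := by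
    rw [ae_iff] at hae
    have h1 := Measure.addHaar_preimage_linearMap volume hdet
      {x | ¬(f x ∈ X → g x ∈ Y → h x ∈ A)}
    rw [hae, mul_zero] at h1
    refine measure_mono_null (fun q hq => ?_) h1
    simp only [mem_compl_iff, mem_ofPred_eq, mem_preimage] at hq ⊢
    rw [hdec, hfT, hgT]
    convert hq using 4
    field_simp
  have hvol : ∀ {γ : ℝ} {Z : Set ℝ} {ρ : ℝ}, γ ≠ 0 → volume Z = ENNReal.ofReal (2 * ρ) →
      volume ((fun y => γ⁻¹ * y) ⁻¹' Z) = ENNReal.ofReal (2 * (|γ| * ρ)) := fun hγ hZ => by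
    rw [Real.volume_preimage_mul_left (inv_ne_zero hγ), hZ, ← ENNReal.ofReal_mul (abs_nonneg _),
      inv_inv]
    congr 1; ring
  have hX' := hvol hα0 hX
  have hY' := hvol hβ0 hY
  have hXr : volume.real ((fun y => α⁻¹ * y) ⁻¹' X) = 2 * (|α| * p) := by
    rw [measureReal_def, hX', ENNReal.toReal_ofReal (by positivity)]
  have hYr : volume.real ((fun y => β⁻¹ * y) ⁻¹' Y) = 2 * (|β| * q) := by
    rw [measureReal_def, hY', ENNReal.toReal_ofReal (by positivity)]
  have hAr : volume.real A = 2 * r := by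
    rw [measureReal_def, hA, ENNReal.toReal_ofReal (by positivity)]
  have hα' := abs_pos.2 hα0
  have hβ' := abs_pos.2 hβ0
  obtain ⟨⟨c, hc⟩, ⟨d, hd⟩⟩ := ae_eq_Icc_of_add (A := A) (measurable_const_mul _ hXm)
    (measurable_const_mul _ hYm) (hX' ▸ ENNReal.ofReal_ne_top) (hY' ▸ ENNReal.ofReal_ne_top)
    (hA ▸ ENNReal.ofReal_ne_top)
    (by rw [hXr]; positivity) (by rw [hYr]; positivity) hae' (by
      obtain ⟨x, hx1, hx2, hx3⟩ := htight
      rw [hAr, hXr, hYr, ← hx3, hdec]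
      have e1 : f x * α ≤ p * |α| := (le_abs_self _).trans (by rw [abs_mul]; gcongr)
      have e2 : g x * β ≤ q * |β| := (le_abs_self _).trans (by rw [abs_mul]; gcongr)
      linarith)
  rw [hXr, mul_div_cancel_left₀ _ two_ne_zero] at hc
  rw [hYr, mul_div_cancel_left₀ _ two_ne_zero] at hd
  obtain ⟨z, hz1, hz2⟩ := exists_dual hfg (α⁻¹ * c) (β⁻¹ * d)
  refine ⟨z, ?_, ?_⟩
  · have := ae_eq_Icc_of_preimage_mul (inv_ne_zero hα0) hc
    rwa [abs_inv, inv_mul_cancel_left₀ hα'.ne', ← hz1] at this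
  · have := ae_eq_Icc_of_preimage_mul (inv_ne_zero hβ0) hd
    rwa [abs_inv, inv_mul_cancel_left₀ hβ'.ne', ← hz2] at this

end Forms

section Recovery

variable {ι : Type*} {L : ι → (ℝ × ℝ →ₗ[ℝ] ℝ)} {s : Finset ι} {hs : s.Nonempty} {w v : ℝ × ℝ}
  {a : ι → ℝ} {E : ι → Set ℝ} {k : ι}

/-- A set containing almost all projections of a polygon with larger slices in the interior
is an interval. -/
lemma ae_eq_Icc_of_ae_polygon (hsurj : ∀ i, Function.Surjective (L i))
    (hw : L k w = 1) (hv : L k v = 0) (hv0 : v ≠ 0) (hc : ∀ i ∈ s, L i v ≠ 0) {z : ℝ × ℝ}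
    {r : ℝ} {A : Set ℝ} (hAm : MeasurableSet A) (hA : volume A = ENNReal.ofReal (2 * r))
    (hE : ∀ i ∈ s, E i =ᵐ[volume] Icc (L i z - a i) (L i z + a i))
    (hae : ∀ᵐ x, x ∈ region L s E → L k x ∈ A)
    (hlen : ∀ t, |t| < r → 0 < sliceLen s hs (slope L w v) (halfLen L v a) t) :
    A =ᵐ[volume] Icc (L k z - r) (L k z + r) := by
  set S : Set (ℝ × ℝ) := {x | x - z ∈ polygon L s a ∧ L k x ∉ A} with hS
  have hSm : MeasurableSet S :=
    ((measurable_id.sub_const z) measurableSet_polygon).inter (measurable_form (L k) hAm).compl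
  have hS0 : volume S = 0 := by
    have h1 : ∀ᵐ x, ∀ i ∈ s, (L i x ∈ E i ↔ L i x ∈ Icc (L i z - a i) (L i z + a i)) :=
      (ae_ball_iff s.countable_toSet).2 fun i hi => ae_form (hsurj i) (hE i hi).mem_iff
    refine measure_eq_zero_iff_ae_notMem.2 ?_
    filter_upwards [h1, hae] with x hx1 hx2 hxS
    refine hxS.2 (hx2 fun i hi => (hx1 i hi).2 ?_)
    have := hxS.1 i hi
    rw [map_sub] at this
    have := abs_le.1 this
    constructor <;> linarith
  obtain ⟨C, hC0, -, hC⟩ := volume_eq_lintegral_slices hw hv hv0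
  obtain ⟨τ₀, hτ₀⟩ := exists_frame_coord hw hv hv0 z
  rw [hC S hSm, mul_eq_zero] at hS0
  have hmeas : Measurable fun t : ℝ => volume {τ : ℝ | t • w + τ • v ∈ S} :=
    measurable_measure_prodMk_left (ν := (volume : Measure ℝ))
      ((LinearMap.continuous_of_finiteDimensional (frameMap w v)).measurable hSm)
  have h2 := (lintegral_eq_zero_iff hmeas).1 (hS0.resolve_left hC0)
  have h3 : ∀ᵐ t, |t - L k z| < r → t ∈ A := by
    filter_upwards [h2] with t ht htr
    by_contra htA
    have h4 : {τ : ℝ | t • w + τ • v ∈ S} = (fun τ => τ + -τ₀) ⁻¹'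
        {τ : ℝ | (t - L k z) • w + τ • v ∈ polygon L s a} := by
      ext τ
      have e1 : L k (t • w + τ • v) = t := by simp [hw, hv]
      have e2 : t • w + τ • v - z = (t - L k z) • w + (τ + -τ₀) • v := by
        conv_lhs => rw [hτ₀]
        module
      simp only [hS, mem_ofPred_eq, mem_preimage, e1, htA, not_false_eq_true, and_true, e2]
    have h5 : volume {τ : ℝ | t • w + τ • v ∈ S} =
        ENNReal.ofReal (sliceLen s hs (slope L w v) (halfLen L v a) (t - L k z)) := by
      rw [h4, measure_preimage_add_right, volume_polygon_slice hc]
    have h6 := hlen _ htr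
    rw [h5] at ht
    exact absurd (ENNReal.ofReal_eq_zero.1 ht) (not_le.2 h6)
  have h7 : Icc (L k z - r) (L k z + r) ≤ᵐ[volume] A := by
    refine Ioo_ae_eq_Icc.symm.le.trans ?_
    filter_upwards [h3] with t ht htI
    exact ht (abs_lt.2 ⟨by linarith [htI.1], by linarith [htI.2]⟩)
  refine (ae_eq_of_ae_subset_of_measure_ge h7 ?_ measurableSet_Icc.nullMeasurableSet
    (hA ▸ ENNReal.ofReal_ne_top)).symm
  rw [hA, Real.volume_Icc]
  exact ENNReal.ofReal_le_ofReal (by linarith)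

/-- The center of an interval is determined by that of its truncation. -/
lemma center_eq {U : ι → Set ℝ} {i : ι} {c d : ℝ} {z : ℝ × ℝ} (hi : L i v ≠ 0)
    (hU : IsUpperSet (U i)) (hE : E i =ᵐ[volume] Icc (c - a i) (c + a i))
    (hpos : 0 < shrink L v d a i)
    (hEU : truncate L v U E i =ᵐ[volume]
      Icc (L i z - shrink L v d a i) (L i z + shrink L v d a i)) :
    c = L i (z + (d / 2) • v) := by
  have h1 := ae_eq_Icc_preimage_mul hi hE
  have h2 := ae_eq_Icc_preimage_mul hi hEU
  have h3 : (fun y => L i v * y) ⁻¹' truncate L v U E i =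
      (fun y => L i v * y) ⁻¹' E i \ U i := by
    ext y; simp [truncate, hi]
  rw [h3] at h2
  have h4 : 0 < shrink L v d a i / |L i v| := div_pos hpos (abs_pos.2 hi)
  have h5 := left_endpoint_eq hU h1 h2 (by linarith)
  have h6 := halfLen_shrink (a := a) hi d
  rw [halfLen, halfLen] at h6
  rw [h6] at h5
  have h7 : c / L i v = L i z / L i v + d / 2 := by linarith
  rw [map_add, map_smul, smul_eq_mul, ← div_mul_cancel₀ c hi, h7, add_mul, div_mul_cancel₀ _ hi]

end Recovery

section Equality

variable {ι : Type*} {L : ι → (ℝ × ℝ →ₗ[ℝ] ℝ)} {s : Finset ι} {hs : s.Nonempty} {w v : ℝ × ℝ}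
  {a : ι → ℝ} {E : ι → Set ℝ} {k : ι} {d : ℝ}

/-- Every strip touches the boundary of the polygon. -/
def Tight (L : ι → (ℝ × ℝ →ₗ[ℝ] ℝ)) (s : Finset ι) (a : ι → ℝ) : Prop :=
  ∀ i ∈ s, ∃ x ∈ polygon L s a, |L i x| = a i

lemma neg_mem_polygon {x : ℝ × ℝ} (hx : x ∈ polygon L s a) : -x ∈ polygon L s a := fun i hi => by
  rw [map_neg, abs_neg]; exact hx i hi

lemma sliceLen_nonneg_of_mem (hw : L k w = 1) (hv : L k v = 0) (hv0 : v ≠ 0)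
    (hc : ∀ i ∈ s, L i v ≠ 0) {x : ℝ × ℝ} (hx : x ∈ polygon L s a) :
    0 ≤ sliceLen s hs (slope L w v) (halfLen L v a) (L k x) := by
  obtain ⟨τ, hτ⟩ := exists_frame_coord hw hv hv0 x
  rw [hτ, smul_add_smul_mem_polygon_iff (hs := hs) hc] at hx
  have := hx.1.trans hx.2
  rw [sliceLen]; linarith

lemma sliceLen_nonneg_of_abs (hw : L k w = 1) (hv : L k v = 0) (hv0 : v ≠ 0)
    (hc : ∀ i ∈ s, L i v ≠ 0) {x : ℝ × ℝ} (hx : x ∈ polygon L s a) (hxk : |L k x| = a k) :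
    0 ≤ sliceLen s hs (slope L w v) (halfLen L v a) (a k) := by
  rw [← hxk, sliceLen_abs]
  exact sliceLen_nonneg_of_mem hw hv hv0 hc hx

lemma exists_mem_polygon_shrink (hw : L k w = 1) (hv : L k v = 0) (hc : ∀ i ∈ s, L i v ≠ 0) (t : ℝ)
    (hd : d ≤ sliceLen s hs (slope L w v) (halfLen L v a) t) :
    ∃ x ∈ polygon L s (shrink L v d a), L k x = t := by
  refine ⟨t • w + (upperEnd s hs (slope L w v) (halfLen L v a) t - d / 2) • v, ?_, by simp [hw, hv]⟩
  rw [smul_add_smul_mem_polygon_iff (hs := hs) hc, upperEnd_shrink hc, upperEnd_shrink hc]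
  rw [sliceLen] at hd
  constructor <;> linarith

lemma mem_polygon_of_insert [DecidableEq ι] {x : ℝ × ℝ} (hx : x ∈ polygon L (insert k s) a) :
    x ∈ polygon L s a := fun i hi => hx i (Finset.mem_insert_of_mem hi)

/-- A point where the strip `i` is active can be chosen on the upper side of the strip. -/
lemma exists_mem_polygon_upper {i : ι} {x : ℝ × ℝ} (hx : x ∈ polygon L s a)
    (hxi : |L i x| = a i) : ∃ y ∈ polygon L s a, L i y / L i v = halfLen L v a i := by
  have h1 : |L i x / L i v| = halfLen L v a i := by rw [abs_div, hxi, halfLen]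
  rcases abs_choice (L i x / L i v) with h | h <;> rw [h] at h1
  · exact ⟨x, hx, h1⟩
  · exact ⟨-x, neg_mem_polygon hx, by rw [map_neg, neg_div, h1]⟩

lemma tight_shrink [DecidableEq ι] (ht : Tight L (insert k s) a) (hw : L k w = 1) (hv : L k v = 0)
    (hv0 : v ≠ 0) (hc : ∀ i ∈ s, L i v ≠ 0)
    (ha : ∀ i ∈ s, 0 ≤ shrink L v d a i)
    (hd : d = sliceLen s hs (slope L w v) (halfLen L v a) (a k)) :
    Tight L s (shrink L v d a) := by
  intro i hi
  obtain ⟨x, hx, hxi⟩ := ht i (Finset.mem_insert_of_mem hi)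
  obtain ⟨y, hy, hyi⟩ := exists_mem_polygon_upper (v := v) hx hxi
  have hyk := hy k (Finset.mem_insert_self _ _)
  obtain ⟨τ, hτ⟩ := exists_frame_coord hw hv hv0 y
  generalize L k y = t at hyk hτ
  have h1 := sliceLen_anti (s := s) (hs := hs) (m := slope L w v) (b := halfLen L v a)
    (hyk.trans (le_abs_self _))
  rw [← hd, sliceLen] at h1
  have h2 := mem_polygon_of_insert hy
  rw [hτ, smul_add_smul_mem_polygon_iff (hs := hs) hc] at h2
  have h3 := upperEnd_le (hs := hs) (m := slope L w v) (b := halfLen L v a) hi t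
  rw [hτ, form_smul_add_smul (hc i hi), mul_div_cancel_left₀ _ (hc i hi)] at hyi
  have h4 := h2.2
  refine ⟨t • w + (τ - d / 2) • v, ?_, ?_⟩
  · rw [smul_add_smul_mem_polygon_iff (hs := hs) hc, upperEnd_shrink hc, upperEnd_shrink hc]
    constructor <;> linarith
  · have h5 := halfLen_shrink (a := a) (hc i hi) d
    have h6 : 0 ≤ halfLen L v (shrink L v d a) i := div_nonneg (ha i hi) (abs_nonneg _)
    rw [form_smul_add_smul (hc i hi), show τ - d / 2 + slope L w v i * t =
      halfLen L v (shrink L v d a) i by rw [h5]; linarith, abs_mul,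
      abs_of_nonneg h6, halfLen_mul (hc i hi)]

/-- The conclusion of the equality theorem for the constraints in `s`. -/
def IsIntervals (L : ι → (ℝ × ℝ →ₗ[ℝ] ℝ)) (s : Finset ι) (E : ι → Set ℝ) (a : ι → ℝ) (z : ℝ × ℝ) :
    Prop :=
  ∀ i ∈ s, E i =ᵐ[volume] Icc (L i z - a i) (L i z + a i)

/-- Removal of one constraint in the equality case, when no truncated set vanishes. -/
lemma exists_truncate_isIntervals [DecidableEq ι] (hsurj : ∀ i, Function.Surjective (L i))
    (hnd : ∀ i j, i ≠ j → ∀ x, L i x = 0 → L j x = 0 → x = 0) (hst : s.Nontrivial) (hks : k ∉ s)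
    (hw : L k w = 1) (hv : L k v = 0) (hv0 : v ≠ 0)
    (hE : ∀ i ∈ insert k s, MeasurableSet (E i)) (ha : ∀ i ∈ insert k s, 0 < a i)
    (hEa : ∀ i ∈ insert k s, volume (E i) = ENNReal.ofReal (2 * a i))
    (ht : Tight L (insert k s) a)
    (heq : volume (region L (insert k s) E) = volume (polygon L (insert k s) a))
    (hd : d = sliceLen s hs (slope L w v) (halfLen L v a) (a k))
    (ha' : ∀ i ∈ s, 0 < shrink L v d a i)
    (ih : 3 ≤ s.card → ∀ (E : ι → Set ℝ) (a : ι → ℝ), (∀ i ∈ s, MeasurableSet (E i)) →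
      (∀ i ∈ s, 0 < a i) → (∀ i ∈ s, volume (E i) = ENNReal.ofReal (2 * a i)) → Tight L s a →
      volume (region L s E) = volume (polygon L s a) → ∃ z, IsIntervals L s E a z) :
    ∃ (U : ι → Set ℝ) (z : ℝ × ℝ), (∀ i ∈ s, IsUpperSet (U i)) ∧
      IsIntervals L s (truncate L v U E) (shrink L v d a) z ∧
      E k =ᵐ[volume] Icc (L k z - a k) (L k z + a k) := by
  have hc := form_ne_zero hnd hks hv hv0
  have hk := Finset.mem_insert_self k s
  obtain ⟨x₀, hx₀, hx₀k⟩ := ht k hk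
  have hd0 : 0 ≤ sliceLen s hs (slope L w v) (halfLen L v a) (a k) :=
    sliceLen_nonneg_of_abs hw hv hv0 hc (mem_polygon_of_insert hx₀) hx₀k
  obtain ⟨U, hUu, hUm, hU, h1, h2⟩ := exists_truncate_of_volume_eq (hs := hs) hsurj hnd hst hks
    hw hv hv0 hE (fun i hi => (ha i hi).le) hEa heq (hd.trans (max_eq_left hd0).symm)
  have hEm : ∀ i ∈ s, MeasurableSet (truncate L v U E i) := fun i hi =>
    measurableSet_truncate (hE i (Finset.mem_insert_of_mem hi)) (hUm i hi)
  have hz : ∃ z, IsIntervals L s (truncate L v U E) (shrink L v d a) z := by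
    by_cases h3 : 3 ≤ s.card
    · exact ih h3 _ _ hEm ha' hU
        (tight_shrink ht hw hv hv0 hc (fun i hi => (ha' i hi).le) hd) h1
    · have h4 : s.card = 2 := by
        have := Finset.one_lt_card_iff_nontrivial.2 hst
        omega
      obtain ⟨i, j, hij, rfl⟩ := Finset.card_eq_two.1 h4
      have hi : i ∈ ({i, j} : Finset ι) := by simp
      have hj : j ∈ ({i, j} : Finset ι) := by simp
      have hik : i ≠ k := fun h => hks (h ▸ hi)
      have hjk : j ≠ k := fun h => hks (h ▸ hj)
      obtain ⟨x, hx, hxk⟩ := exists_mem_polygon_shrink hw hv hc (a k) hd.le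
      obtain ⟨z, hz1, hz2⟩ := ae_eq_Icc_of_three_forms (hnd i j hij) (hnd i k hik) (hnd j k hjk)
        (ha' i hi) (ha' j hj) (ha k hk).le (hEm i hi) (hEm j hj) (hU i hi) (hU j hj) (hEa k hk)
        (by
          filter_upwards [h2] with x hx hxi hxj
          exact hx (by simpa [region] using ⟨hxi, hxj⟩))
        ⟨x, hx i hi, hx j hj, hxk⟩
      exact ⟨z, by simpa [IsIntervals] using ⟨hz1, hz2⟩⟩
  obtain ⟨z, hz⟩ := hz
  refine ⟨U, z, hUu, hz, ?_⟩
  refine ae_eq_Icc_of_ae_polygon (hs := hs) hsurj hw hv hv0 hc (hE k hk) (hEa k hk) hz h2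
    fun t htk => ?_
  rw [sliceLen_shrink hc, sub_pos, hd]
  refine sliceLen_lt (htk.trans_le (le_abs_self _)) ?_
  obtain ⟨i, hi, h⟩ := s.exists_mem_eq_inf' hs fun i => halfLen L v a i - slope L w v i * 0
  have h5 : sliceLen s hs (slope L w v) (halfLen L v a) 0 = 2 * halfLen L v a i := by
    simp only [sliceLen, upperEnd, neg_zero, h]; ring
  have h6 := halfLen_shrink (a := a) (hc i hi) d
  have h7 : 0 < halfLen L v (shrink L v d a) i := div_pos (ha' i hi) (abs_pos.2 (hc i hi))
  rw [h5, ← hd]; linarith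

/-- The strip `k` contributes a side of positive length to the polygon. -/
def HasSide (L : ι → (ℝ × ℝ →ₗ[ℝ] ℝ)) (s : Finset ι) (a : ι → ℝ) (k : ι) : Prop :=
  ∃ x ∈ polygon L s a, ∃ y ∈ polygon L s a, x ≠ y ∧ L k x = a k ∧ L k y = a k

lemma sliceLen_le_zero_of_not_hasSide [DecidableEq ι] (hw : L k w = 1) (hv : L k v = 0)
    (hv0 : v ≠ 0) (hc : ∀ i ∈ s, L i v ≠ 0) (hak : 0 ≤ a k) (h : ¬HasSide L (insert k s) a k) :
    sliceLen s hs (slope L w v) (halfLen L v a) (a k) ≤ 0 := by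
  by_contra! hlt
  rw [sliceLen] at hlt
  have hLk : ∀ τ : ℝ, L k (a k • w + τ • v) = a k := fun τ => by simp [hw, hv]
  have key : ∀ τ ∈ Icc (-upperEnd s hs (slope L w v) (halfLen L v a) (-a k))
      (upperEnd s hs (slope L w v) (halfLen L v a) (a k)),
      a k • w + τ • v ∈ polygon L (insert k s) a := fun τ hτ => by
    intro i hi
    rcases Finset.mem_insert.1 hi with rfl | hi
    · rw [hLk, abs_of_nonneg hak]
    · exact (smul_add_smul_mem_polygon_iff (hs := hs) hc _ _).2 hτ i hi
  refine h ⟨_, key _ ⟨le_rfl, by linarith⟩, _, key _ ⟨by linarith, le_rfl⟩, fun he => ?_, hLk _,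
    hLk _⟩
  have := smul_left_injective ℝ hv0 (add_left_cancel he)
  linarith

lemma slope_ne (hnd : ∀ i j, i ≠ j → ∀ x, L i x = 0 → L j x = 0 → x = 0) (hw : L k w = 1)
    (hv : L k v = 0) {i j : ι} (hij : i ≠ j) (hi : L i v ≠ 0) (hj : L j v ≠ 0) :
    slope L w v i ≠ slope L w v j := fun h => by
  have h1 : w - slope L w v i • v = 0 := by
    refine hnd i j hij _ ?_ ?_
    · rw [map_sub, map_smul, slope, smul_eq_mul, div_mul_cancel₀ _ hi, sub_self]
    · rw [h, map_sub, map_smul, slope, smul_eq_mul, div_mul_cancel₀ _ hj, sub_self]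
  have h2 := congrArg (L k) h1
  simp [hw, hv] at h2

lemma shrink_pos_of_hasSide [DecidableEq ι]
    (hnd : ∀ i j, i ≠ j → ∀ x, L i x = 0 → L j x = 0 → x = 0) (hw : L k w = 1)
    (hv : L k v = 0) (hv0 : v ≠ 0) (hc : ∀ i ∈ s, L i v ≠ 0) (hst : s.Nontrivial)
    (hside : ∀ i ∈ s, HasSide L (insert k s) a i)
    (hd : d = sliceLen s hs (slope L w v) (halfLen L v a) (a k)) :
    ∀ i ∈ s, 0 < shrink L v d a i := by
  intro i hi
  obtain ⟨j, hj, hji⟩ := hst.exists_ne i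
  by_contra! hle
  have h1 : halfLen L v (shrink L v d a) i ≤ 0 := div_nonpos_of_nonpos_of_nonneg hle (abs_nonneg _)
  rw [halfLen_shrink (hc i hi), hd, sliceLen] at h1
  have i1 := upperEnd_le (hs := hs) (m := slope L w v) (b := halfLen L v a) hi (a k)
  have i2 := upperEnd_le (hs := hs) (m := slope L w v) (b := halfLen L v a) hi (-a k)
  have j1 := upperEnd_le (hs := hs) (m := slope L w v) (b := halfLen L v a) hj (a k)
  have j2 := upperEnd_le (hs := hs) (m := slope L w v) (b := halfLen L v a) hj (-a k)
  set D := slope L w v j - slope L w v i with hD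
  have hD0 : D ≠ 0 := sub_ne_zero.2 (slope_ne hnd hw hv hji (hc j hj) (hc i hi))
  have h2 : |D * a k| ≤ halfLen L v a j - halfLen L v a i := by
    rw [abs_le]; constructor <;> rw [hD] <;> linarith
  -- the active points of the strip `j` are determined
  have key : ∀ z ∈ polygon L (insert k s) a, L j z / L j v = halfLen L v a j →
      D * L k z = halfLen L v a j - halfLen L v a i := by
    intro z hz hzj
    obtain ⟨τ, hτ⟩ := exists_frame_coord hw hv hv0 z
    have hzk := hz k (Finset.mem_insert_self _ _)
    have hzi := hz i (Finset.mem_insert_of_mem hi)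
    rw [hτ, form_smul_add_smul (hc j hj), mul_div_cancel_left₀ _ (hc j hj)] at hzj
    rw [hτ, abs_form_le_iff (hc i hi)] at hzi
    have h3 := (abs_le.1 hzi).2
    have h4 : D * L k z ≤ |D * a k| := by
      rw [abs_mul]
      refine (le_abs_self _).trans ?_
      rw [abs_mul]
      exact mul_le_mul_of_nonneg_left (hzk.trans (le_abs_self _)) (abs_nonneg _)
    have h5 : D * L k z = slope L w v j * L k z - slope L w v i * L k z := by rw [hD]; ring
    linarith
  obtain ⟨x, hx, y, hy, hxy, hxj, hyj⟩ := hside j hj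
  have huniq : ∀ x ∈ polygon L (insert k s) a, ∀ y ∈ polygon L (insert k s) a,
      L j x = L j y → L j x / L j v = halfLen L v a j → x = y := by
    intro x hx y hy hxy hxj
    have h6 := key x hx hxj
    have h7 := key y hy (hxy ▸ hxj)
    have h8 : L k x = L k y := mul_left_cancel₀ hD0 (h6.trans h7.symm)
    refine sub_eq_zero.1 (hnd j k ?_ _ (by rw [map_sub, hxy, sub_self])
      (by rw [map_sub, h8, sub_self]))
    rintro rfl
    exact hc _ hj hv
  have h9 : |L j x| = a j := by
    have h10 := hx j (Finset.mem_insert_of_mem hj)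
    rw [hxj] at h10 ⊢
    exact abs_of_nonneg ((abs_nonneg _).trans h10)
  have h11 : |L j x / L j v| = halfLen L v a j := by rw [abs_div, h9, halfLen]
  rcases abs_choice (L j x / L j v) with h | h <;> rw [h] at h11
  · exact hxy (huniq x hx y hy (hxj.trans hyj.symm) h11)
  · refine hxy (neg_injective (huniq (-x) (neg_mem_polygon hx) (-y) (neg_mem_polygon hy) ?_ ?_))
    · rw [map_neg, map_neg, hxj, hyj]
    · rw [map_neg, neg_div, h11]

/-- The equality case of the Brascamp-Lieb-Luttinger inequality in the plane. -/
theorem exists_isIntervals (hsurj : ∀ i, Function.Surjective (L i))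
    (hnd : ∀ i j, i ≠ j → ∀ x, L i x = 0 → L j x = 0 → x = 0) :
    3 ≤ s.card → ∀ (E : ι → Set ℝ) (a : ι → ℝ), (∀ i ∈ s, MeasurableSet (E i)) →
      (∀ i ∈ s, 0 < a i) → (∀ i ∈ s, volume (E i) = ENNReal.ofReal (2 * a i)) → Tight L s a →
      volume (region L s E) = volume (polygon L s a) → ∃ z, IsIntervals L s E a z := by
  classical
  induction s using Finset.strongInduction with
  | H s ih =>
    intro hcard E a hE ha hEa ht heq
    have hst : ∀ k ∈ s, (s.erase k).Nontrivial := fun k hk => by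
      rw [← Finset.one_lt_card_iff_nontrivial, Finset.card_erase_of_mem hk]; omega
    by_cases hside : ∀ k ∈ s, HasSide L s a k
    · have step : ∀ k ∈ s, ∃ (v : ℝ × ℝ) (d : ℝ) (U : ι → Set ℝ) (z : ℝ × ℝ), L k v = 0 ∧
          (∀ i ∈ s.erase k, L i v ≠ 0) ∧ (∀ i ∈ s.erase k, 0 < shrink L v d a i) ∧
          (∀ i ∈ s.erase k, IsUpperSet (U i)) ∧
          IsIntervals L (s.erase k) (truncate L v U E) (shrink L v d a) z ∧
          E k =ᵐ[volume] Icc (L k z - a k) (L k z + a k) := by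
        intro k hk
        obtain ⟨w, v, hw, hv, hv0⟩ := exists_frame (hsurj k)
        have hks : k ∉ s.erase k := Finset.notMem_erase k s
        have hc := form_ne_zero hnd hks hv hv0
        have hins := Finset.insert_erase hk
        have hpos := shrink_pos_of_hasSide (hs := (hst k hk).nonempty) hnd hw hv hv0 hc (hst k hk)
          (by rw [hins]; exact fun i hi => hside i (Finset.mem_of_mem_erase hi)) rfl
        obtain ⟨U, z, h1, h2, h3⟩ := exists_truncate_isIntervals (hs := (hst k hk).nonempty)
          (E := E) hsurj hnd (hst k hk) hks hw hv hv0 (by rwa [hins]) (by rwa [hins])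
          (by rwa [hins]) (by rwa [hins]) (by rwa [hins]) rfl hpos
          (ih _ (Finset.erase_ssubset hk))
        exact ⟨v, _, U, z, hv, hc, hpos, h1, h2, h3⟩
      have hs : s.Nonempty := Finset.card_pos.1 (by omega)
      obtain ⟨k, hk⟩ := hs
      obtain ⟨v, d, U, z, hv, hc, hpos, hU, h_int, hEk⟩ := step k hk
      refine ⟨z + (d / 2) • v, fun i hi => ?_⟩
      by_cases hik : i = k
      · rw [hik, map_add, map_smul, hv, smul_zero, add_zero]
        exact hEk
      · have hi' := Finset.mem_erase.2 ⟨hik, hi⟩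
        obtain ⟨-, -, -, z', -, -, -, -, -, hEi⟩ := step i hi
        rw [← center_eq (hc i hi') (hU i hi') hEi (hpos i hi') (h_int i hi')]
        exact hEi
    · push Not at hside
      obtain ⟨k, hk, hnside⟩ := hside
      obtain ⟨w, v, hw, hv, hv0⟩ := exists_frame (hsurj k)
      have hks : k ∉ s.erase k := Finset.notMem_erase k s
      have hc := form_ne_zero hnd hks hv hv0
      have hins := Finset.insert_erase hk
      obtain ⟨x₀, hx₀, hx₀k⟩ := ht k hk
      have hd : 0 = sliceLen (s.erase k) (hst k hk).nonempty (slope L w v) (halfLen L v a) (a k) :=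
        le_antisymm (sliceLen_nonneg_of_abs hw hv hv0 hc
          (mem_polygon_of_insert (k := k) (by rwa [hins])) hx₀k)
          (sliceLen_le_zero_of_not_hasSide hw hv hv0 hc (ha k hk).le (by rwa [hins]))
      have hshrink : ∀ i, shrink L v 0 a i = a i := fun i => by simp [shrink]
      obtain ⟨U, z, h1, h2, h3⟩ := exists_truncate_isIntervals
          (E := E) hsurj hnd (hst k hk) hks hw hv hv0 (by rwa [hins]) (by rwa [hins])
          (by rwa [hins]) (by rwa [hins]) (by rwa [hins]) hd
          (fun i hi => by rw [hshrink]; exact ha i (Finset.mem_of_mem_erase hi))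
          (ih _ (Finset.erase_ssubset hk))
      refine ⟨z, fun i hi => ?_⟩
      by_cases hik : i = k
      · rw [hik]; exact h3
      · have h4 := h2 i (Finset.mem_erase.2 ⟨hik, hi⟩)
        rw [hshrink] at h4
        refine (ae_eq_of_ae_subset_of_measure_ge (h4.symm.le.trans
          (LE.le.eventuallyLE fun x hx => hx.1)) ?_
          measurableSet_Icc.nullMeasurableSet (hEa i hi ▸ ENNReal.ofReal_ne_top)).symm
        rw [hEa i hi, Real.volume_Icc]
        exact ENNReal.ofReal_le_ofReal (by linarith)

end Equality

end BLL

/-- Main theorem: for a nondegenerate family of surjective linear maps `ℝ² → ℝ` and an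
admissible tuple of sets, equality `I(E₁,…,Eₙ) = I(E₁^*,…,Eₙ^*)` forces each `E i` to
coincide, up to a null set, with an interval centered at `L i z` for a common `z ∈ ℝ²`. -/
theorem stmt8 (n : ℕ) (hn : 3 ≤ n) (L : Fin n → (ℝ × ℝ →ₗ[ℝ] ℝ))
    (hsurj : ∀ i, Function.Surjective (L i))
    (hnd : ∀ i j, i ≠ j → Function.Bijective (fun p : ℝ × ℝ => (L i p, L j p)))
    (E : Fin n → Set ℝ) (hmeas : ∀ i, MeasurableSet (E i))
    (hpos : ∀ i, 0 < volume (E i)) (hfin : ∀ i, volume (E i) < ⊤)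
    -- admissibility: no strip contains an open neighborhood of the intersection of the others
    (hadm : ¬ ∃ k : Fin n, ∃ U : Set (ℝ × ℝ), IsOpen U ∧
      (⋂ j ∈ ({k}ᶜ : Set (Fin n)), (L j) ⁻¹' (symInt (E j))) ⊆ U ∧
      U ⊆ (L k) ⁻¹' (symInt (E k)))
    (heq : volume (⋂ i, (L i) ⁻¹' (E i)) = volume (⋂ i, (L i) ⁻¹' (symInt (E i)))) :
    ∃ z : ℝ × ℝ, ∃ h : Fin n → ℝ, (∀ i, 0 ≤ h i) ∧
      ∀ i, volume (symmDiff (E i) (Icc (L i z - h i) (L i z + h i))) = 0 := by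
  set a : Fin n → ℝ := fun i => (volume (E i)).toReal / 2 with ha
  have hapos : ∀ i, 0 < a i := fun i => half_pos (ENNReal.toReal_pos (hpos i).ne' (hfin i).ne)
  have hsym : ∀ i, symInt (E i) = Icc (-a i) (a i) := fun i => by rw [symInt, ha, neg_div]
  have hker : ∀ i j, i ≠ j → ∀ x, L i x = 0 → L j x = 0 → x = 0 := fun i j hij x hi hj =>
    (hnd i j hij).1 (by simp [hi, hj])
  have htight : BLL.Tight L Finset.univ a := by
    intro k _
    by_contra! hk
    refine hadm ⟨k, {x | |L k x| < a k}, ?_, fun x hx => ?_, fun x hx => ?_⟩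
    · exact isOpen_lt (LinearMap.continuous_of_finiteDimensional (L k)).abs continuous_const
    · have hx' : ∀ j ≠ k, |L j x| ≤ a j := by
        simpa [hsym, abs_le] using hx
      by_contra hlt
      have hle : a k ≤ |L k x| := not_lt.1 hlt
      have hpos' : 0 < |L k x| := (hapos k).trans_le hle
      have hc0 : 0 ≤ a k / |L k x| := (div_pos (hapos k) hpos').le
      have habs : ∀ j, |L j ((a k / |L k x|) • x)| = a k / |L k x| * |L j x| := fun j => by
        rw [map_smul, smul_eq_mul, abs_mul, abs_of_nonneg hc0]
      have hkk : |L k ((a k / |L k x|) • x)| = a k := by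
        rw [habs, div_mul_cancel₀ _ hpos'.ne']
      refine hk _ (fun j _ => ?_) hkk
      by_cases hjk : j = k
      · rw [hjk, hkk]
      · rw [habs]
        exact (mul_le_of_le_one_left (abs_nonneg _) ((div_le_one hpos').2 hle)).trans (hx' j hjk)
    · rw [hsym]
      exact abs_le.1 (le_of_lt hx)
  obtain ⟨z, hz⟩ := BLL.exists_isIntervals (s := Finset.univ) hsurj hker (by simpa using hn) E a
    (fun i _ => hmeas i) (fun i _ => hapos i)
    (fun i _ => by rw [ha, mul_div_cancel₀ _ two_ne_zero, ENNReal.ofReal_toReal (hfin i).ne])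
    htight (by
      have h1 : BLL.region L Finset.univ E = ⋂ i, L i ⁻¹' E i := by ext x; simp [BLL.region]
      have h2 : BLL.polygon L Finset.univ a = ⋂ i, L i ⁻¹' symInt (E i) := by
        ext x; simp [BLL.polygon, hsym, abs_le]
      rw [h1, h2, heq])
  exact ⟨z, a, fun i => (hapos i).le, fun i =>
    measure_symmDiff_eq_zero_iff.2 (hz i (Finset.mem_univ i))⟩
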